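/- Explicit evaluation of the off-diagonal main-term transform (Theorem 1.2): Fix η > 40, H ∈ C_η, and α = (α₁, α₂, α₃) ∈ ℂ³ with Re α_i = 0 and α₁ + α₂ + α₃ = 0. Then for every s ∈ ℂ with 1/2 + 1/100 < Re s < 1, (F_α H)(2s−1, s) = π^{1/2−s} · ∏_{i=1}^{3} (Γ(s − 1/2 + α_i/2)/Γ(1 − s − α_i/2)) · (1/(2π)) ∫_ℝ (H(it)/(Γ(it)Γ(−it))) · ∏_{i=1}^{3} Γ((1 − s + α_i + it)/2) Γ((1 − s + α_i − it)/2) dt. -/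

import Mathlib

open Complex MeasureTheory Set

/-- The K-Bessel function `K_μ(x) = ∫₀^∞ exp(−x cosh t) cosh(μt) dt`. -/
noncomputable def KBessel (μ : ℂ) (x : ℝ) : ℂ :=
  ∫ t in Ioi (0:ℝ), Complex.exp (-(x : ℂ) * (Real.cosh t : ℂ)) * Complex.cosh (μ * (t : ℂ))

/-- The GL(2) Whittaker function `W_μ(y) = 2√y K_μ(2πy)`. -/
noncomputable def W2 (μ : ℂ) (y : ℝ) : ℂ :=
  2 * (Real.sqrt y : ℂ) * KBessel μ (2 * Real.pi * y)

/-- The class `C_η` of test functions. -/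
def MemCeta (η : ℝ) (H : ℂ → ℂ) : Prop :=
  DifferentiableOn ℂ H {μ : ℂ | |μ.re| < 2 * η} ∧
  (∀ μ : ℂ, |μ.re| < 2 * η → H (-μ) = H μ) ∧
  ∃ C : ℝ, ∀ μ : ℂ, |μ.re| < 2 * η → ‖H μ‖ ≤ C * Real.exp (-2 * Real.pi * |μ.im|)

/-- The inverse Kontorovich–Lebedev transform. -/
noncomputable def Hflat (H : ℂ → ℂ) (y : ℝ) : ℂ :=
  (1 / (4 * (Real.pi : ℂ))) * ∫ t : ℝ,
    H (t * I) * W2 (t * I) y / (Complex.Gamma (t * I) * Complex.Gamma (-(t * I)))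

/-- Mellin transform `ĥ(w) := ∫₀^∞ h(y) y^{w−1} dy`. -/
noncomputable def mellinT (h : ℝ → ℂ) (w : ℂ) : ℂ :=
  ∫ y in Ioi (0:ℝ), h y * (y : ℂ) ^ (w - 1)

/-- The archimedean transform `(F_α H)(s₀, s)` (at `φ = π/2`, in its streamlined
Mellin–Barnes form), a double integral over `s₁ = (η − 1/2) + it₁` and
`u = 1/100 + iv`. -/
noncomputable def FtransMain (η : ℝ) (α : Fin 3 → ℂ) (H : ℂ → ℂ) (s0 s : ℂ) : ℂ :=
  (Real.sqrt Real.pi : ℂ) * (1 / (2 * (Real.pi : ℂ))) ^ 2 *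
    ∫ t1 : ℝ, ∫ v : ℝ,
      let s1 : ℂ := ((η : ℝ) - 1/2 : ℝ) + t1 * Complex.I
      let u : ℂ := 1/100 + v * Complex.I
      mellinT (Hflat H) (s - s1 - 1/2) * (Real.pi : ℂ) ^ (-s1) *
        ((∏ i, Complex.Gamma ((s1 - α i) / 2)) / Complex.Gamma ((1 + s1) / 2 - s0)) *
        (Complex.Gamma (u / 2) * Complex.Gamma ((s1 - s0 + u) / 2 + 1/2 - s) *
          (∏ i, Complex.Gamma ((s0 - u + α i) / 2)) * Complex.Gamma (s - (s0 + u) / 2)) /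
        (Complex.Gamma ((1 - u) / 2) * Complex.Gamma ((s0 - u + s1) / 2))

/-- The Gamma function on a vertical line is dominated by its value on the real axis. -/
theorem norm_Gamma_le_Gamma_re {z : ℂ} (hz : 0 < z.re) :
    ‖Complex.Gamma z‖ ≤ Real.Gamma z.re := by
  rw [Complex.Gamma_eq_integral hz, Real.Gamma_eq_integral hz, GammaIntegral]
  refine (norm_integral_le_integral_norm _).trans_eq ?_
  refine setIntegral_congr_fun measurableSet_Ioi fun x hx => ?_
  simp only [norm_mul, norm_real, Real.norm_eq_abs, Real.abs_exp]
  rw [norm_cpow_eq_rpow_re_of_pos hx]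
  simp

theorem norm_Gamma_le_div {z : ℂ} (hz : 0 < z.re) :
    ‖Complex.Gamma z‖ ≤ Real.Gamma (z.re + 2) / (z.re ^ 2 + z.im ^ 2) := by
  have hz0 : z ≠ 0 := fun h => by simp [h] at hz
  have hz1 : z + 1 ≠ 0 := fun h => by
    have := congrArg re h
    simp at this
    linarith
  have hrec : Complex.Gamma (z + 2) = (z + 1) * (z * Complex.Gamma z) := by
    rw [← Complex.Gamma_add_one z hz0, ← Complex.Gamma_add_one (z + 1) hz1]
    ring_nf
  have hn : ‖z‖ * ‖z‖ = z.re ^ 2 + z.im ^ 2 := by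
    rw [← sq, Complex.sq_norm, Complex.normSq_apply]
    ring
  have h1 : ‖z‖ ≤ ‖z + 1‖ := by
    rw [Complex.norm_def, Complex.norm_def]
    apply Real.sqrt_le_sqrt
    simp only [normSq_apply, add_re, one_re, add_im, one_im]
    nlinarith
  have h2 := norm_Gamma_le_Gamma_re (z := z + 2) (by simp; linarith)
  rw [le_div_iff₀ (by positivity), ← hn]
  calc ‖Complex.Gamma z‖ * (‖z‖ * ‖z‖) ≤ ‖Complex.Gamma z‖ * (‖z + 1‖ * ‖z‖) := by gcongr
    _ = ‖Complex.Gamma (z + 2)‖ := by rw [hrec]; simp only [norm_mul]; ring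
    _ ≤ _ := by simpa using h2

/-- Quadratic decay of the Gamma function, uniform in vertical strips. -/
theorem exists_norm_Gamma_le {σ₁ σ₂ : ℝ} (h₁ : 0 < σ₁) :
    ∃ C : ℝ, 0 ≤ C ∧ ∀ z : ℂ, σ₁ ≤ z.re → z.re ≤ σ₂ →
      ‖Complex.Gamma z‖ ≤ C * (1 + z.im ^ 2)⁻¹ := by
  have hc : ContinuousOn Real.Gamma (Icc (σ₁ + 2) (σ₂ + 2)) := fun x hx =>
    (Real.differentiableAt_Gamma fun m => by
      have := hx.1
      have : (0 : ℝ) ≤ m := m.cast_nonneg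
      intro h; linarith).continuousAt.continuousWithinAt
  obtain ⟨M, hM⟩ := isCompact_Icc.exists_bound_of_continuousOn hc
  refine ⟨|M| * (1 + (σ₁ ^ 2)⁻¹), by positivity, fun z hz₁ hz₂ => ?_⟩
  have hz : 0 < z.re := h₁.trans_le hz₁
  refine (norm_Gamma_le_div hz).trans ?_
  have h2 : Real.Gamma (z.re + 2) ≤ |M| :=
    (le_abs_self _).trans ((hM _ ⟨by linarith, by linarith⟩).trans (le_abs_self _))
  rw [div_eq_mul_inv, mul_assoc]
  refine mul_le_mul h2 ?_ (by positivity) (by positivity)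
  rw [← div_eq_mul_inv, le_div_iff₀ (by positivity), inv_mul_le_iff₀ (by positivity)]
  have h3 : σ₁ ^ 2 ≤ z.re ^ 2 := by gcongr
  have h4 : 1 ≤ z.re ^ 2 * (σ₁ ^ 2)⁻¹ := by
    rw [← div_eq_mul_inv, one_le_div (by positivity)]; exact h3
  nlinarith [mul_nonneg (sq_nonneg z.im) (inv_nonneg.mpr (sq_nonneg σ₁)), sq_nonneg z.re]

theorem differentiableAt_Gamma_of_re_pos {z : ℂ} (hz : 0 < z.re) :
    DifferentiableAt ℂ Complex.Gamma z :=
  Complex.differentiableAt_Gamma z fun m h => by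
    have := congrArg re h
    have hm : (0 : ℝ) ≤ m := m.cast_nonneg
    simp at this
    linarith

theorem continuous_Gamma_comp {X : Type*} [TopologicalSpace X] {f : X → ℂ} (hf : Continuous f)
    (h : ∀ x, 0 < (f x).re) : Continuous fun x => Complex.Gamma (f x) :=
  continuous_iff_continuousAt.mpr fun x =>
    (differentiableAt_Gamma_of_re_pos (h x)).continuousAt.comp hf.continuousAt

theorem integrable_of_norm_le_inv_one_add_sq {f : ℝ → ℂ} (hf : Continuous f) {C : ℝ}
    (h : ∀ t, ‖f t‖ ≤ C * (1 + t ^ 2)⁻¹) : Integrable f :=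
  (integrable_inv_one_add_sq.const_mul C).mono' hf.aestronglyMeasurable (.of_forall h)

theorem integrable_Gamma_add_mul_I {a : ℂ} (ha : 0 < a.re) :
    Integrable fun t : ℝ => Complex.Gamma (a + t * I) := by
  obtain ⟨C, -, hC⟩ := exists_norm_Gamma_le (σ₂ := a.re) ha
  have h := integrable_of_norm_le_inv_one_add_sq (C := C)
    (f := fun t : ℝ => Complex.Gamma (a + (t - a.im : ℝ) * I))
    (continuous_Gamma_comp (by fun_prop) (by simp [ha])) fun t => by
      simpa using hC (a + (t - a.im : ℝ) * I) (by simp) (by simp)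
  simpa using h.comp_add_right a.im

/-- Shifting a vertical line of integration within a strip of holomorphy. -/
theorem integral_vertical_line_eq {f : ℂ → ℂ} {a b C : ℝ} (hab : a ≤ b)
    (hf : ∀ z : ℂ, a ≤ z.re → z.re ≤ b → DifferentiableAt ℂ f z)
    (hC : ∀ z : ℂ, a ≤ z.re → z.re ≤ b → ‖f z‖ ≤ C * (1 + z.im ^ 2)⁻¹) :
    ∫ t : ℝ, f (a + t * I) = ∫ t : ℝ, f (b + t * I) := by
  have hcont : ∀ c : ℝ, a ≤ c → c ≤ b → Continuous fun t : ℝ => f (c + t * I) := fun c h1 h2 =>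
    continuous_iff_continuousAt.mpr fun t =>
      ContinuousAt.comp (f := fun t : ℝ => (c : ℂ) + t * I)
        (hf _ (by simpa using h1) (by simpa using h2)).continuousAt (by fun_prop)
  have hInt : ∀ c : ℝ, a ≤ c → c ≤ b → Integrable fun t : ℝ => f (c + t * I) := fun c h1 h2 =>
    integrable_of_norm_le_inv_one_add_sq (hcont c h1 h2) fun t => by
      simpa using hC (c + t * I) (by simpa using h1) (by simpa using h2)
  have hrect : ∀ T : ℝ, (∫ x : ℝ in a..b, f (x + (-T : ℝ) * I)) - (∫ x : ℝ in a..b, f (x + T * I))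
      + I • (∫ y : ℝ in (-T)..T, f (b + y * I)) - I • (∫ y : ℝ in (-T)..T, f (a + y * I)) = 0 := by
    intro T
    have := integral_boundary_rect_eq_zero_of_differentiableOn f (a + (-T : ℝ) * I) (b + T * I) ?_
    · simpa using this
    · intro z hz
      have hz' := hz.1
      simp only [add_re, ofReal_re, mul_re, I_re, mul_zero, ofReal_im, I_im, mul_one, sub_self,
        add_zero, mem_preimage, uIcc_of_le hab, mem_Icc] at hz'
      exact (hf z hz'.1 hz'.2).differentiableWithinAt
  have hhor : ∀ ε : ℝ, |ε| = 1 → Filter.Tendsto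
      (fun T : ℝ => ∫ x : ℝ in a..b, f (x + (ε * T : ℝ) * I)) Filter.atTop (nhds 0) := by
    intro ε hε
    have hε2 : ε ^ 2 = 1 := by rw [← sq_abs, hε]; norm_num
    have hb : ∀ T : ℝ, ‖∫ x : ℝ in a..b, f (x + (ε * T : ℝ) * I)‖ ≤
        C * (1 + T ^ 2)⁻¹ * |b - a| := by
      intro T
      refine intervalIntegral.norm_integral_le_of_norm_le_const fun x hx => ?_
      rw [uIoc_of_le hab] at hx
      have := hC (x + (ε * T : ℝ) * I) (by simpa using hx.1.le) (by simpa using hx.2)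
      simpa [mul_pow, hε2] using this
    refine squeeze_zero_norm hb ?_
    have h0 : Filter.Tendsto (fun T : ℝ => (1 + T ^ 2)⁻¹) Filter.atTop (nhds 0) :=
      Filter.Tendsto.inv_tendsto_atTop <| Filter.tendsto_atTop_add_const_left _ _ <|
        Filter.tendsto_pow_atTop two_ne_zero
    simpa using (h0.const_mul C).mul_const |b - a|
  have hver : ∀ c : ℝ, a ≤ c → c ≤ b → Filter.Tendsto
      (fun T : ℝ => I • ∫ y : ℝ in (-T)..T, f (c + y * I)) Filter.atTop
      (nhds (I • ∫ y : ℝ, f (c + y * I))) := fun c h1 h2 =>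
    (intervalIntegral_tendsto_integral (hInt c h1 h2) Filter.tendsto_neg_atTop_atBot
      Filter.tendsto_id).const_smul I
  have hlim := (((hhor (-1) (by simp)).sub (hhor 1 (by simp))).add (hver b hab le_rfl)).sub
    (hver a le_rfl hab)
  have h0 := tendsto_nhds_unique (hlim.congr fun T => by simpa using hrect T) tendsto_const_nhds
  simp only [sub_zero, zero_add, smul_eq_mul, ← mul_sub, mul_eq_zero, I_ne_zero, false_or] at h0
  exact (sub_eq_zero.mp h0).symm

/-- Fourier inversion with the kernel `exp (i t x)`. -/
theorem integral_exp_mul_integral_exp {f : ℝ → ℂ} (hf : Continuous f) (hi : Integrable f)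
    (hF : Integrable fun t : ℝ => ∫ x : ℝ, Complex.exp (t * x * I) * f x) (r : ℝ) :
    ∫ t : ℝ, Complex.exp (-(t * r * I)) * ∫ x : ℝ, Complex.exp (t * x * I) * f x =
      2 * Real.pi * f r := by
  set F : ℝ → ℂ := fun t => ∫ x : ℝ, Complex.exp (t * x * I) * f x with hFdef
  have hpi : (-(2 * Real.pi)) ≠ 0 := by simp [Real.pi_ne_zero]
  have h1 : FourierTransform.fourier f = fun ξ : ℝ => F (-(2 * Real.pi) * ξ) := by
    ext ξ
    rw [Real.fourier_real_eq_integral_exp_smul]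
    simp only [hFdef, smul_eq_mul]
    congr 1 with x
    congr 2
    push_cast
    ring
  have h2 : Integrable (FourierTransform.fourier f) := by
    rw [h1]
    exact hF.comp_mul_left' hpi
  have h3 := congrFun (hf.fourierInv_fourier_eq hi h2) r
  rw [Real.fourierInv_eq', h1] at h3
  have h4 := Measure.integral_comp_mul_left
    (fun t : ℝ => Complex.exp (-(t * r * I)) * F t) (-(2 * Real.pi))
  rw [← h3]
  have h5 : (∫ v : ℝ, Complex.exp (↑(2 * Real.pi * inner ℝ v r) * I) • F (-(2 * Real.pi) * v)) =
      ∫ x : ℝ, (fun t : ℝ => Complex.exp (-(t * r * I)) * F t) (-(2 * Real.pi) * x) := by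
    congr 1 with v
    simp only [smul_eq_mul]
    congr 2
    simp
    ring
  rw [h5, h4, abs_inv, abs_neg, abs_of_pos (by positivity : (0 : ℝ) < 2 * Real.pi)]
  rw [Complex.real_smul]
  have : (Real.pi : ℂ) ≠ 0 := by exact_mod_cast Real.pi_ne_zero
  push_cast
  rw [← mul_assoc, mul_inv_cancel₀ (by simp), one_mul]

/-- The integrand of the Beta integral after the logistic substitution. -/
noncomputable def betaKernel (p q : ℂ) (r : ℝ) : ℂ :=
  (Real.sigmoid r : ℂ) ^ p * ((1 - Real.sigmoid r : ℝ) : ℂ) ^ q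

theorem betaKernel_mul (p q p' q' : ℂ) (r : ℝ) :
    betaKernel p q r * betaKernel p' q' r = betaKernel (p + p') (q + q') r := by
  have h1 : (Real.sigmoid r : ℂ) ≠ 0 := by exact_mod_cast (Real.sigmoid_pos r).ne'
  have h2 : ((1 - Real.sigmoid r : ℝ) : ℂ) ≠ 0 := by
    exact_mod_cast (sub_pos.mpr (Real.sigmoid_lt_one r)).ne'
  rw [betaKernel, betaKernel, betaKernel, cpow_add _ _ h1, cpow_add _ _ h2]
  ring

theorem exp_mul_eq_betaKernel (x : ℂ) (r : ℝ) :
    Complex.exp (x * r) = betaKernel x (-x) r := by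
  have h1 := Real.sigmoid_pos r
  have h2 : 0 < 1 - Real.sigmoid r := sub_pos.mpr (Real.sigmoid_lt_one r)
  have h3 : Real.log (1 - Real.sigmoid r) = Real.log (Real.sigmoid r) - r := by
    rw [← Real.sigmoid_neg, ← Real.sigmoid_mul_rexp_neg,
      Real.log_mul h1.ne' (Real.exp_pos _).ne', Real.log_exp]
    ring
  rw [betaKernel, cpow_def_of_ne_zero (by exact_mod_cast h1.ne'),
    cpow_def_of_ne_zero (by exact_mod_cast h2.ne'), ← ofReal_log h1.le, ← ofReal_log h2.le, h3,
    ← Complex.exp_add]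
  congr 1
  push_cast
  ring

theorem exp_mul_betaKernel (x p q : ℂ) (r : ℝ) :
    Complex.exp (x * r) * betaKernel p q r = betaKernel (p + x) (q - x) r := by
  rw [exp_mul_eq_betaKernel, betaKernel_mul]
  ring_nf

theorem continuous_betaKernel (p q : ℂ) : Continuous (betaKernel p q) := by
  have hs : Continuous Real.sigmoid := _root_.continuous_sigmoid
  refine Continuous.mul ?_ ?_ <;> refine continuous_iff_continuousAt.mpr fun r => ?_
  · exact ContinuousAt.cpow (by fun_prop) continuousAt_const
      (Or.inl (by simpa using Real.sigmoid_pos r))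
  · exact ContinuousAt.cpow (by fun_prop) continuousAt_const
      (Or.inl (by simpa using Real.sigmoid_lt_one r))

theorem abs_deriv_sigmoid_smul (p q : ℂ) (r : ℝ) :
    |Real.sigmoid r * (1 - Real.sigmoid r)| •
      ((Real.sigmoid r : ℂ) ^ (p - 1) * (1 - (Real.sigmoid r : ℂ)) ^ (q - 1)) =
      betaKernel p q r := by
  have h1 := Real.sigmoid_pos r
  have h2 : 0 < 1 - Real.sigmoid r := sub_pos.mpr (Real.sigmoid_lt_one r)
  have h1' : (Real.sigmoid r : ℂ) ≠ 0 := by exact_mod_cast h1.ne'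
  have h2' : ((1 - Real.sigmoid r : ℝ) : ℂ) ≠ 0 := by exact_mod_cast h2.ne'
  have h3 : (1 - (Real.sigmoid r : ℂ)) = ((1 - Real.sigmoid r : ℝ) : ℂ) := by push_cast; ring
  rw [abs_of_pos (by positivity), Complex.real_smul, betaKernel, h3, cpow_sub _ _ h1',
    cpow_sub _ _ h2', cpow_one, cpow_one]
  push_cast at h2' ⊢
  field_simp

theorem integrable_betaKernel {p q : ℂ} (hp : 0 < p.re) (hq : 0 < q.re) :
    Integrable (betaKernel p q) := by
  have h := (intervalIntegrable_iff_integrableOn_Ioo_of_le zero_le_one).mp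
    (betaIntegral_convergent hp hq)
  rw [← Real.range_sigmoid, ← image_univ,
    integrableOn_image_iff_integrableOn_abs_deriv_smul MeasurableSet.univ
      (fun x _ => (Real.hasDerivAt_sigmoid x).hasDerivWithinAt) Real.sigmoid_injective.injOn,
    integrableOn_univ] at h
  exact h.congr (.of_forall fun r => abs_deriv_sigmoid_smul p q r)

theorem integral_betaKernel {p q : ℂ} (hp : 0 < p.re) (hq : 0 < q.re) :
    ∫ r, betaKernel p q r = Complex.Gamma p * Complex.Gamma q / Complex.Gamma (p + q) := by
  rw [← betaIntegral_eq_Gamma_mul_div p q hp hq, betaIntegral,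
    intervalIntegral.integral_of_le zero_le_one, integral_Ioc_eq_integral_Ioo,
    ← Real.range_sigmoid, ← image_univ,
    integral_image_eq_integral_abs_deriv_smul MeasurableSet.univ
      (fun x _ => (Real.hasDerivAt_sigmoid x).hasDerivWithinAt) Real.sigmoid_injective.injOn,
    setIntegral_univ]
  exact (integral_congr_ae (.of_forall fun r => abs_deriv_sigmoid_smul p q r)).symm

/-- Multiplication by a Gamma factor with constant real part preserves integrability. -/
theorem MeasureTheory.Integrable.mul_Gamma {X : Type*} [TopologicalSpace X] [MeasurableSpace X]
    [OpensMeasurableSpace X] {μ : Measure X} {f : X → ℂ} (hf : Integrable f μ) {g : X → ℂ}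
    (hg : Continuous g) {σ : ℝ} (hσ : 0 < σ) (h : ∀ x, (g x).re = σ) :
    Integrable (fun x => f x * Complex.Gamma (g x)) μ := by
  refine hf.mul_bdd (c := Real.Gamma σ)
    (continuous_Gamma_comp hg fun x => (h x).symm ▸ hσ).aestronglyMeasurable
    (.of_forall fun x => ?_)
  rw [← h x]
  exact norm_Gamma_le_Gamma_re ((h x).symm ▸ hσ)

theorem integral_exp_mul_betaKernel {a c : ℂ} (ha : 0 < a.re) (hc : 0 < c.re) (t : ℝ) :
    ∫ r : ℝ, Complex.exp (t * r * I) * betaKernel a c r =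
      Complex.Gamma (a + t * I) * Complex.Gamma (c - t * I) / Complex.Gamma (a + c) := by
  have h : ∀ r : ℝ, Complex.exp (t * r * I) * betaKernel a c r =
      betaKernel (a + t * I) (c - t * I) r := fun r => by
    rw [← exp_mul_betaKernel]; ring_nf
  simp_rw [h]
  rw [integral_betaKernel (by simpa using ha) (by simpa using hc)]
  ring_nf

/-- **The first Barnes lemma.** -/
theorem barnes_first_lemma {a b c d : ℂ} (ha : 0 < a.re) (hb : 0 < b.re) (hc : 0 < c.re)
    (hd : 0 < d.re) :
    ∫ t : ℝ, Complex.Gamma (a + t * I) * Complex.Gamma (b + t * I) * Complex.Gamma (c - t * I) *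
        Complex.Gamma (d - t * I) =
      2 * Real.pi * (Complex.Gamma (a + c) * Complex.Gamma (a + d) * Complex.Gamma (b + c) *
        Complex.Gamma (b + d)) / Complex.Gamma (a + b + c + d) := by
  have hac : Complex.Gamma (a + c) ≠ 0 := Gamma_ne_zero_of_re_pos (by simp; positivity)
  have hbd : Complex.Gamma (d + b) ≠ 0 := Gamma_ne_zero_of_re_pos (by simp; positivity)
  set F : ℝ → ℂ := fun t => ∫ r : ℝ, Complex.exp (t * r * I) * betaKernel a c r with hF
  have hFint : Integrable F := by
    have := ((integrable_Gamma_add_mul_I ha).mul_Gamma (g := fun t : ℝ => c - t * I)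
      (by fun_prop) hc (by simp)).div_const (Complex.Gamma (a + c))
    exact this.congr (.of_forall fun t => (integral_exp_mul_betaKernel ha hc t).symm)
  have hinv := integral_exp_mul_integral_exp (continuous_betaKernel a c)
    (integrable_betaKernel ha hc) hFint
  have hprod : ∀ t : ℝ, Complex.Gamma (a + t * I) * Complex.Gamma (b + t * I) *
      Complex.Gamma (c - t * I) * Complex.Gamma (d - t * I) =
      (Complex.Gamma (a + c) * Complex.Gamma (d + b)) *
        ∫ r : ℝ, F t * (Complex.exp (-(t * r * I)) * betaKernel d b r) := by
    intro t
    have h2 := integral_exp_mul_betaKernel hd hb (-t)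
    have h3 : ∀ r : ℝ, Complex.exp (((-t : ℝ) : ℂ) * r * I) = Complex.exp (-(t * r * I)) :=
      fun r => by congr 1; push_cast; ring
    simp_rw [h3] at h2
    rw [integral_const_mul, h2, hF]
    simp only []
    rw [integral_exp_mul_betaKernel ha hc t]
    push_cast
    rw [neg_mul, sub_neg_eq_add, ← sub_eq_add_neg]
    field_simp
  have hswap : ∫ t : ℝ, ∫ r : ℝ, F t * (Complex.exp (-(t * r * I)) * betaKernel d b r) =
      ∫ r : ℝ, ∫ t : ℝ, F t * (Complex.exp (-(t * r * I)) * betaKernel d b r) := by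
    refine integral_integral_swap ?_
    have h := (hFint.mul_prod (integrable_betaKernel hd hb)).mul_bdd (c := 1)
      (g := fun z : ℝ × ℝ => Complex.exp (-(z.1 * z.2 * I)))
      (Continuous.aestronglyMeasurable (by fun_prop)) (.of_forall fun z => by
        rw [Complex.norm_exp]; simp)
    refine h.congr (.of_forall fun z => ?_)
    simp only [Function.uncurry]
    ring
  simp_rw [hprod]
  rw [integral_const_mul, hswap]
  have hinner : ∀ r : ℝ, ∫ t : ℝ, F t * (Complex.exp (-(t * r * I)) * betaKernel d b r) =
      2 * Real.pi * betaKernel (a + d) (c + b) r := by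
    intro r
    rw [← betaKernel_mul, ← mul_assoc, ← hinv r, ← integral_mul_const]
    congr 1 with t
    ring
  simp_rw [hinner]
  rw [integral_const_mul, integral_betaKernel (by simp; positivity) (by simp; positivity)]
  ring_nf

/-- **The second Barnes lemma.** -/
theorem barnes_second_lemma {a b c d e : ℂ} (ha : 0 < a.re) (hb : 0 < b.re) (hc : 0 < c.re)
    (hd : 0 < d.re) (he : 0 < e.re) :
    ∫ t : ℝ, Complex.Gamma (a + t * I) * Complex.Gamma (b + t * I) * Complex.Gamma (c + t * I) *
        Complex.Gamma (d - t * I) * Complex.Gamma (e - t * I) /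
          Complex.Gamma (a + b + c + d + e + t * I) =
      2 * Real.pi * (Complex.Gamma (a + d) * Complex.Gamma (a + e) * Complex.Gamma (b + d) *
        Complex.Gamma (b + e) * Complex.Gamma (c + d) * Complex.Gamma (c + e)) /
        (Complex.Gamma (b + c + d + e) * Complex.Gamma (a + c + d + e) *
          Complex.Gamma (a + b + d + e)) := by
  obtain ⟨δ, hδ, hδ'⟩ := exists_between (lt_min hb hc)
  have hδb : δ < b.re := hδ'.trans_le (min_le_left _ _)
  have hδc : δ < c.re := hδ'.trans_le (min_le_right _ _)
  have hP : Complex.Gamma (a + b + d + e) ≠ 0 := Gamma_ne_zero_of_re_pos (by simp; positivity)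
  have hR : Complex.Gamma (a + c + d + e) ≠ 0 := Gamma_ne_zero_of_re_pos (by simp; positivity)
  have hpi : (Real.pi : ℂ) ≠ 0 := by exact_mod_cast Real.pi_ne_zero
  have hb' : 0 < (b - δ).re := by simp; linarith
  have hc' : 0 < (c - δ).re := by simp; linarith
  have hd' : 0 < (d + δ).re := by simp; linarith
  have he' : 0 < (e + δ).re := by simp; linarith
  have hD' : 0 < (a + d + e + δ).re := by simp; linarith
  set f : ℝ → ℂ := fun t => Complex.Gamma (a + t * I) * Complex.Gamma (d - t * I) *
    Complex.Gamma (e - t * I) with hf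
  set g : ℝ → ℂ := fun x => Complex.Gamma (b - δ + x * I) * Complex.Gamma (c - δ + x * I) *
    Complex.Gamma (a + d + e + δ - x * I) with hg
  have hfi : Integrable f := ((integrable_Gamma_add_mul_I ha).mul_Gamma
    (g := fun t : ℝ => d - t * I) (by fun_prop) hd (by simp)).mul_Gamma
    (g := fun t : ℝ => e - t * I) (by fun_prop) he (by simp)
  have hgi : Integrable g := ((integrable_Gamma_add_mul_I hb').mul_Gamma
    (g := fun x : ℝ => c - δ + x * I) (by fun_prop) hc' (by simp)).mul_Gamma
    (g := fun x : ℝ => a + d + e + δ - x * I) (by fun_prop) hD' (by simp)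
  have hleft : ∀ t : ℝ, Complex.Gamma (a + t * I) * Complex.Gamma (b + t * I) *
      Complex.Gamma (c + t * I) * Complex.Gamma (d - t * I) * Complex.Gamma (e - t * I) /
        Complex.Gamma (a + b + c + d + e + t * I) =
      (2 * Real.pi * (Complex.Gamma (a + b + d + e) * Complex.Gamma (a + c + d + e)))⁻¹ *
        ∫ x : ℝ, f t * g x * Complex.Gamma (δ + t * I - x * I) := by
    intro t
    have h1 := barnes_first_lemma hb' hc' (c := δ + t * I) (by simpa using hδ) hD'
    have h2 : ∫ x : ℝ, f t * g x * Complex.Gamma (δ + t * I - x * I) =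
        f t * ∫ x : ℝ, Complex.Gamma (b - δ + x * I) * Complex.Gamma (c - δ + x * I) *
          Complex.Gamma (δ + t * I - x * I) * Complex.Gamma (a + d + e + δ - x * I) := by
      rw [← integral_const_mul]
      congr 1 with x
      simp only [hg]
      ring
    rw [h2, h1, show b - δ + (δ + t * I) = b + t * I by ring,
      show b - δ + (a + d + e + δ) = a + b + d + e by ring,
      show c - δ + (δ + t * I) = c + t * I by ring,
      show c - δ + (a + d + e + δ) = a + c + d + e by ring,
      show b - δ + (c - δ) + (δ + t * I) + (a + d + e + δ) = a + b + c + d + e + t * I by ring]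
    simp only [hf]
    field_simp
  have hswap : ∫ t : ℝ, ∫ x : ℝ, f t * g x * Complex.Gamma (δ + t * I - x * I) =
      ∫ x : ℝ, ∫ t : ℝ, f t * g x * Complex.Gamma (δ + t * I - x * I) := by
    refine integral_integral_swap ?_
    exact (hfi.mul_prod hgi).mul_Gamma (g := fun z : ℝ × ℝ => δ + z.1 * I - z.2 * I)
      (by fun_prop) hδ (by simp)
  have hinner : ∀ x : ℝ, ∫ t : ℝ, f t * g x * Complex.Gamma (δ + t * I - x * I) =
      2 * Real.pi * (Complex.Gamma (a + d) * Complex.Gamma (a + e)) *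
        (Complex.Gamma (b - δ + x * I) * Complex.Gamma (c - δ + x * I) *
          Complex.Gamma (d + δ - x * I) * Complex.Gamma (e + δ - x * I)) := by
    intro x
    have h1 := barnes_first_lemma ha (b := δ - x * I) (by simpa using hδ) hd he
    have h2 : ∫ t : ℝ, f t * g x * Complex.Gamma (δ + t * I - x * I) =
        g x * ∫ t : ℝ, Complex.Gamma (a + t * I) * Complex.Gamma (δ - x * I + t * I) *
          Complex.Gamma (d - t * I) * Complex.Gamma (e - t * I) := by
      rw [← integral_const_mul]
      congr 1 with t
      simp only [hf]
      rw [show (δ : ℂ) - x * I + t * I = δ + t * I - x * I by ring]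
      ring
    have h3 : Complex.Gamma (a + d + e + δ - x * I) ≠ 0 :=
      Gamma_ne_zero_of_re_pos (by simpa using hD')
    rw [h2, h1, show δ - x * I + d = d + δ - x * I by ring,
      show δ - x * I + e = e + δ - x * I by ring,
      show a + (δ - x * I) + d + e = a + d + e + δ - x * I by ring]
    simp only [hg]
    field_simp
  simp_rw [hleft]
  rw [integral_const_mul, hswap]
  simp_rw [hinner]
  rw [integral_const_mul, barnes_first_lemma hb' hc' hd' he',
    show b - δ + (d + δ) = b + d by ring, show b - δ + (e + δ) = b + e by ring,
    show c - δ + (d + δ) = c + d by ring, show c - δ + (e + δ) = c + e by ring,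
    show b - δ + (c - δ) + (d + δ) + (e + δ) = b + c + d + e by ring]
  field_simp

theorem integrable_exp_neg_mul_abs {c : ℝ} (hc : 0 < c) :
    Integrable fun r : ℝ => Real.exp (-(c * |r|)) := by
  refine (integrable_inv_one_add_sq.const_mul (1 + 2 / c ^ 2)).mono'
    (Continuous.aestronglyMeasurable (by fun_prop)) (.of_forall fun r => ?_)
  have h := Real.quadratic_le_exp_of_nonneg (x := c * |r|) (by positivity)
  rw [Real.norm_eq_abs, Real.abs_exp, Real.exp_neg, ← div_eq_mul_inv,
    inv_le_comm₀ (by positivity) (by positivity), inv_div]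
  refine le_trans ?_ h
  rw [div_le_iff₀ (by positivity), mul_pow, sq_abs]
  have h1 : c ^ 2 * (2 / c ^ 2) = 2 := by field_simp
  have h2 : 0 ≤ c * |r| := by positivity
  have h3 : 0 ≤ 2 / c ^ 2 := by positivity
  nlinarith [mul_nonneg h2 h3, mul_nonneg (sq_nonneg c) (sq_nonneg r)]

theorem integrable_of_norm_le_exp_neg_abs {f : ℝ → ℂ} (hf : Continuous f) {C c : ℝ} (hc : 0 < c)
    (h : ∀ r, ‖f r‖ ≤ C * Real.exp (-(c * |r|))) : Integrable f :=
  ((integrable_exp_neg_mul_abs hc).const_mul C).mono' hf.aestronglyMeasurable (.of_forall h)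

theorem cosh_le_exp_abs (r : ℝ) : Real.cosh r ≤ Real.exp |r| := by
  rw [← Real.cosh_abs, Real.cosh_eq]
  have : Real.exp (-|r|) ≤ Real.exp |r| := Real.exp_le_exp.mpr (by linarith [abs_nonneg r])
  linarith

theorem abs_le_two_mul_cosh (r : ℝ) : |r| ≤ 2 * Real.cosh r := by
  rw [← Real.cosh_abs, Real.cosh_eq]
  linarith [Real.add_one_le_exp |r|, Real.exp_pos (-|r|)]

/-- The Fourier transform of the restriction of `g` to the imaginary axis. -/
noncomputable def axisFourier (g : ℂ → ℂ) (r : ℝ) : ℂ :=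
  ∫ t : ℝ, Complex.exp (r * t * I) * g (t * I)

/-- Functions holomorphic on the closed strip `|Re z| ≤ A` with quadratic decay. -/
structure StripDecay (A C : ℝ) (g : ℂ → ℂ) : Prop where
  differentiableAt : ∀ z : ℂ, |z.re| ≤ A → DifferentiableAt ℂ g z
  norm_le : ∀ z : ℂ, |z.re| ≤ A → ‖g z‖ ≤ C * (1 + z.im ^ 2)⁻¹

namespace StripDecay

variable {A C : ℝ} {g : ℂ → ℂ}

theorem continuous_line (h : StripDecay A C g) {σ : ℝ} (hσ : |σ| ≤ A) :
    Continuous fun t : ℝ => g (σ + t * I) :=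
  continuous_iff_continuousAt.mpr fun t =>
    ContinuousAt.comp (f := fun t : ℝ => (σ : ℂ) + t * I)
      (h.differentiableAt _ (by simpa using hσ)).continuousAt (by fun_prop)

theorem integrable_line (h : StripDecay A C g) {σ : ℝ} (hσ : |σ| ≤ A) :
    Integrable fun t : ℝ => g (σ + t * I) :=
  integrable_of_norm_le_inv_one_add_sq (h.continuous_line hσ) fun t => by
    simpa using h.norm_le (σ + t * I) (by simpa using hσ)

theorem nonneg (h : StripDecay A C g) (hA : 0 ≤ A) : 0 ≤ C := by
  simpa using (norm_nonneg _).trans (h.norm_le 0 (by simpa using hA))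

theorem continuous_axis (h : StripDecay A C g) (hA : 0 ≤ A) :
    Continuous fun t : ℝ => g (t * I) := by
  simpa using h.continuous_line (σ := 0) (by simpa using hA)

theorem integrable_axis (h : StripDecay A C g) (hA : 0 ≤ A) :
    Integrable fun t : ℝ => g (t * I) := by
  simpa using h.integrable_line (σ := 0) (by simpa using hA)

theorem axisFourier_eq_shift (h : StripDecay A C g) {σ : ℝ} (hσ : |σ| ≤ A) (r : ℝ) :
    axisFourier g r = Complex.exp (σ * r) * ∫ t : ℝ, Complex.exp (r * t * I) * g (σ + t * I) := by
  have hA : 0 ≤ A := (abs_nonneg σ).trans hσ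
  have key : ∀ a b : ℝ, a ≤ b → |a| ≤ A → |b| ≤ A →
      ∫ t : ℝ, Complex.exp ((a + t * I) * r) * g (a + t * I) =
        ∫ t : ℝ, Complex.exp ((b + t * I) * r) * g (b + t * I) := by
    intro a b hab ha hb
    have hstrip : ∀ z : ℂ, a ≤ z.re → z.re ≤ b → |z.re| ≤ A := fun z h1 h2 =>
      abs_le.mpr ⟨(abs_le.mp ha).1.trans h1, h2.trans (abs_le.mp hb).2⟩
    refine integral_vertical_line_eq (f := fun z => Complex.exp (z * r) * g z)
      (C := Real.exp (A * |r|) * C) hab (fun z h1 h2 => ?_) (fun z h1 h2 => ?_)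
    · exact (by fun_prop : DifferentiableAt ℂ (fun z : ℂ => Complex.exp (z * r)) z).mul
        (h.differentiableAt z (hstrip z h1 h2))
    · rw [norm_mul, mul_assoc]
      refine mul_le_mul ?_ (h.norm_le z (hstrip z h1 h2)) (norm_nonneg _) (Real.exp_pos _).le
      rw [Complex.norm_exp, Real.exp_le_exp]
      calc (z * r).re ≤ |(z * r).re| := le_abs_self _
        _ = |z.re| * |r| := by simp [abs_mul]
        _ ≤ A * |r| := by gcongr; exact hstrip z h1 h2
  have h0 : axisFourier g r = ∫ t : ℝ, Complex.exp (((0 : ℝ) + t * I) * r) * g ((0 : ℝ) + t * I) := by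
    unfold axisFourier
    congr 1 with t
    simp only [ofReal_zero, zero_add]
    ring_nf
  have h1 : ∫ t : ℝ, Complex.exp ((σ + t * I) * r) * g (σ + t * I) =
      Complex.exp (σ * r) * ∫ t : ℝ, Complex.exp (r * t * I) * g (σ + t * I) := by
    rw [← integral_const_mul]
    congr 1 with t
    rw [← mul_assoc, ← Complex.exp_add]
    ring_nf
  rw [h0, ← h1]
  rcases le_total 0 σ with hs | hs
  · exact key 0 σ hs (by simpa using hA) hσ
  · exact (key σ 0 hs hσ (by simpa using hA)).symm

theorem norm_axisFourier_le (h : StripDecay A C g) (hA : 0 ≤ A) (r : ℝ) :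
    ‖axisFourier g r‖ ≤ C * Real.pi * Real.exp (-(A * |r|)) := by
  have key : ∀ σ : ℝ, |σ| ≤ A → ‖axisFourier g r‖ ≤ C * Real.pi * Real.exp (σ * r) := by
    intro σ hσ
    rw [h.axisFourier_eq_shift hσ, norm_mul, mul_comm]
    have hC := h.nonneg hA
    gcongr
    · rw [← integral_univ_inv_one_add_sq, ← integral_const_mul]
      refine norm_integral_le_of_norm_le (integrable_inv_one_add_sq.const_mul C)
        (.of_forall fun t => ?_)
      rw [norm_mul, Complex.norm_exp]
      simpa using h.norm_le (σ + t * I) (by simpa using hσ)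
    · rw [Complex.norm_exp]
      simp
  rcases le_total 0 r with hr | hr
  · simpa [abs_of_nonneg hr] using key (-A) (by simp [abs_of_nonneg hA])
  · simpa [abs_of_nonpos hr] using key A (by simp [abs_of_nonneg hA])

theorem continuous_axisFourier (h : StripDecay A C g) (hA : 0 ≤ A) :
    Continuous (axisFourier g) := by
  refine continuous_of_dominated (bound := fun t => ‖g (t * I)‖)
    (fun r => ?_) (fun r => .of_forall fun t => ?_) (h.integrable_axis hA).norm
    (.of_forall fun t => by fun_prop)
  · exact ((by fun_prop : Continuous fun t : ℝ => Complex.exp (r * t * I)).mul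
      (h.continuous_axis hA)).aestronglyMeasurable
  · rw [norm_mul, Complex.norm_exp]
    simp

theorem integrable_mul_axisFourier (h : StripDecay A C g) (hA : 0 ≤ A) {f : ℝ → ℂ}
    (hf : Continuous f) {B b : ℝ} (hb : b < A) (hfb : ∀ r, ‖f r‖ ≤ B * Real.exp (b * |r|)) :
    Integrable fun r => f r * axisFourier g r := by
  have hC := h.nonneg hA
  refine integrable_of_norm_le_exp_neg_abs (hf.mul (h.continuous_axisFourier hA))
    (sub_pos.mpr hb) (C := B * (C * Real.pi)) fun r => ?_
  rw [norm_mul]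
  calc ‖f r‖ * ‖axisFourier g r‖
      ≤ (B * Real.exp (b * |r|)) * (C * Real.pi * Real.exp (-(A * |r|))) :=
        mul_le_mul (hfb r) (h.norm_axisFourier_le hA r) (norm_nonneg _)
          ((norm_nonneg _).trans (hfb r))
    _ = B * (C * Real.pi) * (Real.exp (b * |r|) * Real.exp (-(A * |r|))) := by ring
    _ = _ := by rw [← Real.exp_add]; ring_nf

theorem integral_exp_mul_axisFourier (h : StripDecay A C g) {σ : ℝ} (hσ : |σ| < A) :
    ∫ r : ℝ, Complex.exp (-(σ * r)) * axisFourier g r = 2 * Real.pi * g σ := by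
  have hA : 0 ≤ A := (abs_nonneg σ).trans hσ.le
  have heq : ∀ r : ℝ, Complex.exp (-(σ * r)) * axisFourier g r =
      ∫ t : ℝ, Complex.exp (r * t * I) * g (σ + t * I) := fun r => by
    rw [h.axisFourier_eq_shift hσ.le, ← mul_assoc, ← Complex.exp_add]
    simp
  have hInt : Integrable fun r : ℝ => Complex.exp (-(σ * r)) * axisFourier g r := by
    refine h.integrable_mul_axisFourier hA (by fun_prop) (B := 1) hσ fun r => ?_
    rw [Complex.norm_exp, one_mul, Real.exp_le_exp]
    calc (-((σ : ℂ) * r)).re ≤ |(-((σ : ℂ) * r)).re| := le_abs_self _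
      _ = |σ| * |r| := by simp [abs_mul]
  have hinv := integral_exp_mul_integral_exp (h.continuous_line hσ.le) (h.integrable_line hσ.le)
    (hInt.congr (.of_forall heq)) 0
  simp_rw [heq]
  simpa using hinv

theorem integral_cosh_pow_mul_axisFourier (h : StripDecay A C g)
    (hz : ∀ n : ℤ, |(n : ℝ)| < A → g n = 0) {k : ℕ} (hk : (k : ℝ) < A) :
    ∫ r : ℝ, (Real.cosh r : ℂ) ^ k * axisFourier g r = 0 := by
  have hA : 0 ≤ A := k.cast_nonneg.trans hk.le
  have habs : ∀ m ∈ Finset.range (k + 1), |(((k : ℤ) - 2 * m : ℤ) : ℝ)| < A := by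
    intro m hm
    have hm' : m ≤ k := Nat.lt_succ_iff.mp (Finset.mem_range.mp hm)
    refine lt_of_le_of_lt ?_ hk
    have : |(k : ℤ) - 2 * m| ≤ k := abs_le.mpr ⟨by lia, by lia⟩
    exact_mod_cast this
  have hexp : ∀ r : ℝ, (Real.cosh r : ℂ) ^ k * axisFourier g r =
      ∑ m ∈ Finset.range (k + 1), ((2 : ℂ)⁻¹ ^ k * (k.choose m)) *
        (Complex.exp (-((((k : ℤ) - 2 * m : ℤ) : ℝ) * r)) * axisFourier g r) := by
    intro r
    rw [Real.cosh_eq]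
    push_cast
    rw [div_eq_mul_inv, mul_pow, add_pow, mul_comm, Finset.sum_mul, Finset.mul_sum]
    refine Finset.sum_congr rfl fun m hm => ?_
    have hm' : m ≤ k := Nat.lt_succ_iff.mp (Finset.mem_range.mp hm)
    have he : Complex.exp r ^ m * Complex.exp (-r) ^ (k - m) =
        Complex.exp (-(((k : ℂ) - 2 * m) * r)) := by
      rw [← Complex.exp_nat_mul, ← Complex.exp_nat_mul, ← Complex.exp_add, Nat.cast_sub hm']
      ring_nf
    rw [he]
    ring
  have hintm : ∀ m ∈ Finset.range (k + 1), Integrable fun r : ℝ =>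
      ((2 : ℂ)⁻¹ ^ k * (k.choose m)) *
        (Complex.exp (-((((k : ℤ) - 2 * m : ℤ) : ℝ) * r)) * axisFourier g r) := by
    intro m hm
    refine (h.integrable_mul_axisFourier hA (by fun_prop) (B := 1) (habs m hm)
      fun r => ?_).const_mul _
    rw [Complex.norm_exp, one_mul, Real.exp_le_exp, ← abs_mul]
    refine le_trans (le_of_eq ?_) (neg_le_abs _)
    rw [← ofReal_mul, ← ofReal_neg, ofReal_re]
  simp_rw [hexp]
  rw [integral_finsetSum _ hintm]
  refine Finset.sum_eq_zero fun m hm => ?_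
  have := hz _ (habs m hm)
  rw [integral_const_mul, h.integral_exp_mul_axisFourier (habs m hm), ofReal_intCast, this]
  simp

end StripDecay

/-- Taylor expansion of `exp (-x)` with a remainder that is uniform in `x ≥ 0`. -/
theorem exists_abs_exp_neg_sub_sum_le (N : ℕ) : ∃ K : ℝ, 0 ≤ K ∧ ∀ x : ℝ, 0 ≤ x →
    |Real.exp (-x) - ∑ k ∈ Finset.range N, (-x) ^ k / k.factorial| ≤ K * x ^ N := by
  refine ⟨Real.exp 1 + 1 + N, by positivity, fun x hx => ?_⟩
  rcases le_total x 1 with h1 | h1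
  · have h := Complex.norm_exp_sub_sum_le_norm_mul_exp (((-x : ℝ) : ℂ)) N
    rw [Complex.norm_real, Real.norm_eq_abs, abs_neg, abs_of_nonneg hx] at h
    have h2 : Complex.exp ((-x : ℝ) : ℂ) - ∑ m ∈ Finset.range N, ((-x : ℝ) : ℂ) ^ m / m.factorial =
        ((Real.exp (-x) - ∑ k ∈ Finset.range N, (-x) ^ k / k.factorial : ℝ) : ℂ) := by
      push_cast; rfl
    rw [h2, Complex.norm_real, Real.norm_eq_abs] at h
    refine h.trans ?_
    rw [mul_comm]
    gcongr
    have := Real.exp_le_exp.mpr h1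
    have : (0 : ℝ) ≤ N := N.cast_nonneg
    linarith
  · have hxN : 1 ≤ x ^ N := one_le_pow₀ h1
    have hsum : |∑ k ∈ Finset.range N, (-x) ^ k / k.factorial| ≤ N * x ^ N := by
      refine (Finset.abs_sum_le_sum_abs _ _).trans ?_
      calc ∑ k ∈ Finset.range N, |(-x) ^ k / k.factorial| ≤ ∑ k ∈ Finset.range N, x ^ N := by
            refine Finset.sum_le_sum fun k hk => ?_
            rw [abs_div, abs_pow, abs_neg, abs_of_nonneg hx, Nat.abs_cast]
            have hf : (1 : ℝ) ≤ k.factorial := by exact_mod_cast Nat.factorial_pos k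
            refine (div_le_self (by positivity) hf).trans ?_
            exact pow_le_pow_right₀ h1 (Finset.mem_range.mp hk).le
        _ = N * x ^ N := by simp
    have he : |Real.exp (-x)| ≤ 1 * x ^ N := by
      rw [Real.abs_exp, one_mul]
      exact (Real.exp_le_one_iff.mpr (by linarith)).trans hxN
    calc _ ≤ |Real.exp (-x)| + |∑ k ∈ Finset.range N, (-x) ^ k / k.factorial| := abs_sub _ _
      _ ≤ 1 * x ^ N + N * x ^ N := add_le_add he hsum
      _ ≤ _ := by nlinarith [Real.exp_pos 1]

theorem inv_Gamma_mul_Gamma_neg (μ : ℂ) :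
    (Complex.Gamma μ * Complex.Gamma (-μ))⁻¹ = -(μ * Complex.sin (Real.pi * μ)) / Real.pi := by
  rcases eq_or_ne μ 0 with rfl | hμ
  · simp
  have h1 := Complex.Gamma_mul_Gamma_one_sub μ
  rw [show 1 - μ = -μ + 1 by ring, Complex.Gamma_add_one _ (neg_ne_zero.mpr hμ)] at h1
  have h2 : Complex.Gamma μ * Complex.Gamma (-μ) =
      -((Real.pi : ℂ) / Complex.sin (Real.pi * μ) / μ) := by
    rw [← h1]
    field_simp
  rw [h2, inv_neg, inv_div, neg_div, div_div_eq_mul_div]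

/-- The test function weighted by the Kontorovich–Lebedev Plancherel density. -/
noncomputable def plancherelWeight (H : ℂ → ℂ) (μ : ℂ) : ℂ :=
  H μ / (Complex.Gamma μ * Complex.Gamma (-μ))

theorem plancherelWeight_eq (H : ℂ → ℂ) (μ : ℂ) :
    plancherelWeight H μ = H μ * (-(μ * Complex.sin (Real.pi * μ)) / Real.pi) := by
  rw [plancherelWeight, div_eq_mul_inv, inv_Gamma_mul_Gamma_neg]

theorem plancherelWeight_intCast (H : ℂ → ℂ) (n : ℤ) : plancherelWeight H n = 0 := by
  rw [plancherelWeight_eq, mul_comm (Real.pi : ℂ), Complex.sin_int_mul_pi]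
  simp

theorem norm_sin_pi_mul_le (z : ℂ) :
    ‖Complex.sin (Real.pi * z)‖ ≤ Real.exp (Real.pi * |z.im|) := by
  have h : ‖Complex.sin (Real.pi * z)‖ ≤ Real.cosh (Real.pi * z.im) := by
    rw [Complex.sin, norm_div, norm_mul, norm_I, mul_one, Real.cosh_eq, Complex.norm_two]
    gcongr
    refine (norm_sub_le _ _).trans_eq ?_
    rw [Complex.norm_exp, Complex.norm_exp]
    simp
  refine (h.trans (cosh_le_exp_abs _)).trans_eq ?_
  rw [abs_mul, abs_of_pos Real.pi_pos]

theorem stripDecay_plancherelWeight {η A : ℝ} {H : ℂ → ℂ} (hH : MemCeta η H) (hA : 0 ≤ A)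
    (hAη : A < 2 * η) : ∃ C, StripDecay A C (plancherelWeight H) := by
  obtain ⟨hd, -, C₀, hC₀⟩ := hH
  have hopen : IsOpen {μ : ℂ | |μ.re| < 2 * η} :=
    isOpen_lt (continuous_abs.comp continuous_re) continuous_const
  refine ⟨|C₀| * (3 * A + 7), fun z hz => ?_, fun z hz => ?_⟩
  · have h1 : DifferentiableAt ℂ H z := hd.differentiableAt (hopen.mem_nhds (hz.trans_lt hAη))
    rw [show plancherelWeight H = _ from funext (plancherelWeight_eq H)]
    refine h1.mul (DifferentiableAt.div_const ?_ _)
    fun_prop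
  · have h1 := hC₀ z (hz.trans_lt hAη)
    have h2 := norm_sin_pi_mul_le z
    set y := |z.im| with hy
    have hy0 : 0 ≤ y := abs_nonneg _
    have h3 : ‖z‖ ≤ A + y := (Complex.norm_le_abs_re_add_abs_im z).trans (by gcongr)
    have hpi : 1 ≤ Real.pi := by linarith [Real.pi_gt_three]
    have h4 : ‖H z‖ ≤ |C₀| * Real.exp (-2 * Real.pi * y) :=
      h1.trans (mul_le_mul_of_nonneg_right (le_abs_self _) (Real.exp_pos _).le)
    have h5 : ‖plancherelWeight H z‖ ≤
        |C₀| * Real.exp (-2 * Real.pi * y) * ((A + y) * Real.exp (Real.pi * y)) := by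
      rw [plancherelWeight_eq, norm_mul, norm_div, norm_neg, norm_mul]
      refine mul_le_mul h4 ?_ (by positivity) (by positivity)
      have h6 : ‖(Real.pi : ℂ)‖ = Real.pi := by simp [abs_of_pos Real.pi_pos]
      rw [h6]
      exact (div_le_self (by positivity) hpi).trans
        (mul_le_mul h3 h2 (norm_nonneg _) (by positivity))
    refine h5.trans ?_
    have h7 : Real.exp (-2 * Real.pi * y) * Real.exp (Real.pi * y) ≤ Real.exp (-y) := by
      rw [← Real.exp_add, Real.exp_le_exp]
      nlinarith
    have h8 : (A + y) * Real.exp (-y) ≤ (3 * A + 7) * (1 + z.im ^ 2)⁻¹ := by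
      rw [Real.exp_neg, ← div_eq_mul_inv, ← div_eq_mul_inv,
        div_le_div_iff₀ (Real.exp_pos _) (by positivity), ← sq_abs z.im, ← hy]
      have e1 := Real.add_one_le_exp y
      have e2 := Real.pow_div_factorial_le_exp y hy0 2
      have e3 := Real.pow_div_factorial_le_exp y hy0 3
      norm_num [Nat.factorial] at e2 e3
      have e4 : A * (y ^ 2 / 2) ≤ A * Real.exp y := by gcongr
      have e5 : A * (y + 1) ≤ A * Real.exp y := by gcongr
      nlinarith [mul_nonneg hA hy0]
    calc |C₀| * Real.exp (-2 * Real.pi * y) * ((A + y) * Real.exp (Real.pi * y))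
        = |C₀| * ((A + y) * (Real.exp (-2 * Real.pi * y) * Real.exp (Real.pi * y))) := by ring
      _ ≤ |C₀| * ((A + y) * Real.exp (-y)) := by gcongr
      _ ≤ |C₀| * ((3 * A + 7) * (1 + z.im ^ 2)⁻¹) := by gcongr
      _ = _ := by ring

theorem integrable_exp_neg_mul_cosh {x : ℝ} (hx : 0 < x) :
    Integrable fun r : ℝ => ((Real.exp (-(x * Real.cosh r)) : ℝ) : ℂ) := by
  refine integrable_of_norm_le_exp_neg_abs (by fun_prop) (half_pos hx) (C := 1) fun r => ?_
  rw [Complex.norm_real, Real.norm_eq_abs, Real.abs_exp, one_mul, Real.exp_le_exp]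
  nlinarith [abs_le_two_mul_cosh r]

theorem two_mul_KBessel {x : ℝ} (hx : 0 < x) (t : ℝ) :
    2 * KBessel (t * I) x =
      ∫ r : ℝ, ((Real.exp (-(x * Real.cosh r)) : ℝ) : ℂ) * Complex.exp (r * t * I) := by
  have hInt : Integrable fun r : ℝ =>
      ((Real.exp (-(x * Real.cosh r)) : ℝ) : ℂ) * Complex.exp (r * t * I) :=
    (integrable_exp_neg_mul_cosh hx).mul_bdd (c := 1)
      (Continuous.aestronglyMeasurable (by fun_prop)) (.of_forall fun r => by
        rw [Complex.norm_exp]; simp)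
  rw [← intervalIntegral.integral_Iic_add_Ioi hInt.integrableOn hInt.integrableOn (b := 0)]
  have hneg := integral_comp_neg_Ioi 0 fun r : ℝ =>
      ((Real.exp (-(x * Real.cosh r)) : ℝ) : ℂ) * Complex.exp (r * t * I)
  rw [neg_zero] at hneg
  rw [← hneg, ← integral_add hInt.comp_neg.integrableOn hInt.integrableOn, KBessel,
    ← integral_const_mul]
  congr 1 with r
  rw [Complex.cosh, Real.cosh_neg]
  push_cast
  ring_nf

/-- The inverse Kontorovich–Lebedev transform as a Laplace-type integral. -/
theorem Hflat_eq_integral {A C : ℝ} {H : ℂ → ℂ} (hA : 0 ≤ A)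
    (h : StripDecay A C (plancherelWeight H)) {y : ℝ} (hy : 0 < y) :
    Hflat H y = (Real.sqrt y : ℂ) / (4 * Real.pi) *
      ∫ r : ℝ, ((Real.exp (-(2 * Real.pi * y * Real.cosh r)) : ℝ) : ℂ) *
        axisFourier (plancherelWeight H) r := by
  have hx : 0 < 2 * Real.pi * y := by positivity
  have h1 : ∀ t : ℝ, H (t * I) * W2 (t * I) y /
      (Complex.Gamma (t * I) * Complex.Gamma (-(t * I))) =
      (Real.sqrt y : ℂ) * ∫ r : ℝ, plancherelWeight H (t * I) *
        (((Real.exp (-(2 * Real.pi * y * Real.cosh r)) : ℝ) : ℂ) * Complex.exp (r * t * I)) := by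
    intro t
    rw [integral_const_mul, ← two_mul_KBessel hx, W2, plancherelWeight]
    ring
  have hswap : ∫ t : ℝ, ∫ r : ℝ, plancherelWeight H (t * I) *
        (((Real.exp (-(2 * Real.pi * y * Real.cosh r)) : ℝ) : ℂ) * Complex.exp (r * t * I)) =
      ∫ r : ℝ, ∫ t : ℝ, plancherelWeight H (t * I) *
        (((Real.exp (-(2 * Real.pi * y * Real.cosh r)) : ℝ) : ℂ) * Complex.exp (r * t * I)) := by
    refine integral_integral_swap ?_
    refine (((h.integrable_axis hA).mul_prod (integrable_exp_neg_mul_cosh hx)).mul_bdd (c := 1)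
      (g := fun z : ℝ × ℝ => Complex.exp (z.2 * z.1 * I))
      (Continuous.aestronglyMeasurable (by fun_prop)) (.of_forall fun z => by
        rw [Complex.norm_exp]; simp)).congr (.of_forall fun z => ?_)
    simp only [Function.uncurry]
    ring
  rw [Hflat]
  simp_rw [h1]
  rw [integral_const_mul, hswap, ← mul_assoc]
  congr 1
  · ring
  · congr 1 with r
    rw [axisFourier, ← integral_const_mul]
    congr 1 with t
    ring

theorem norm_exp_neg_mul_cosh_le {x : ℝ} (hx : 0 ≤ x) (r : ℝ) :
    ‖((Real.exp (-(x * Real.cosh r)) : ℝ) : ℂ)‖ ≤ Real.exp (-x) := by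
  rw [Complex.norm_real, Real.norm_eq_abs, Real.abs_exp, Real.exp_le_exp]
  nlinarith [Real.one_le_cosh r]

theorem StripDecay.integrable_axisFourier {A C : ℝ} {g : ℂ → ℂ} (h : StripDecay A C g)
    (hA : 0 < A) : Integrable (axisFourier g) := by
  simpa using h.integrable_mul_axisFourier hA.le (f := fun _ => 1) continuous_const hA (B := 1)
    (by simp)

theorem continuousOn_Hflat {A C : ℝ} {H : ℂ → ℂ} (hA : 0 < A)
    (h : StripDecay A C (plancherelWeight H)) : ContinuousOn (Hflat H) (Ioi 0) := by
  refine ContinuousOn.congr ?_ fun y hy => Hflat_eq_integral hA.le h hy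
  refine ContinuousOn.mul (by fun_prop) ?_
  refine continuousOn_of_dominated (bound := fun r => ‖axisFourier (plancherelWeight H) r‖)
    (fun y _ => ?_) (fun y hy => .of_forall fun r => ?_) (h.integrable_axisFourier hA).norm
    (.of_forall fun r => by fun_prop)
  · exact ((by fun_prop : Continuous fun r : ℝ =>
      ((Real.exp (-(2 * Real.pi * y * Real.cosh r)) : ℝ) : ℂ)).mul
      (h.continuous_axisFourier hA.le)).aestronglyMeasurable
  · have hy' : (0 : ℝ) < y := hy
    have hx : 0 ≤ 2 * Real.pi * y := by positivity
    rw [norm_mul]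
    refine mul_le_of_le_one_left (norm_nonneg _) ((norm_exp_neg_mul_cosh_le hx r).trans ?_)
    exact Real.exp_le_one_iff.mpr (by linarith)

theorem norm_sqrt_div_le (y : ℝ) : ‖(Real.sqrt y : ℂ) / (4 * Real.pi)‖ ≤ Real.sqrt y := by
  rw [norm_div, Complex.norm_real, Real.norm_eq_abs, abs_of_nonneg (Real.sqrt_nonneg y)]
  refine div_le_self (Real.sqrt_nonneg y) ?_
  simp only [norm_mul, norm_ofNat, norm_real, Real.norm_eq_abs, abs_of_pos Real.pi_pos]
  linarith [Real.pi_gt_three]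

theorem norm_Hflat_le_exp {A C : ℝ} {H : ℂ → ℂ} (hA : 0 < A)
    (h : StripDecay A C (plancherelWeight H)) :
    ∃ K : ℝ, ∀ y : ℝ, 0 < y → ‖Hflat H y‖ ≤ K * (Real.sqrt y * Real.exp (-(2 * Real.pi * y))) := by
  refine ⟨∫ r, ‖axisFourier (plancherelWeight H) r‖, fun y hy => ?_⟩
  rw [Hflat_eq_integral hA.le h hy, norm_mul]
  have hx : 0 ≤ 2 * Real.pi * y := by positivity
  have h2 : ‖∫ r : ℝ, ((Real.exp (-(2 * Real.pi * y * Real.cosh r)) : ℝ) : ℂ) *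
      axisFourier (plancherelWeight H) r‖ ≤
      Real.exp (-(2 * Real.pi * y)) * ∫ r, ‖axisFourier (plancherelWeight H) r‖ := by
    rw [← integral_const_mul]
    refine norm_integral_le_of_norm_le ((h.integrable_axisFourier hA).norm.const_mul _)
      (.of_forall fun r => ?_)
    rw [norm_mul]
    exact mul_le_mul_of_nonneg_right (norm_exp_neg_mul_cosh_le hx r) (norm_nonneg _)
  calc _ ≤ Real.sqrt y * (Real.exp (-(2 * Real.pi * y)) *
        ∫ r, ‖axisFourier (plancherelWeight H) r‖) :=
      mul_le_mul (norm_sqrt_div_le y) h2 (norm_nonneg _) (Real.sqrt_nonneg y)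
    _ = _ := by ring

/-- Vanishing of the moments of the Fourier transform forces rapid decay of `Hflat` at `0`. -/
theorem norm_Hflat_le_pow {A C : ℝ} {H : ℂ → ℂ}
    (h : StripDecay A C (plancherelWeight H)) {N : ℕ} (hN : (N : ℝ) < A) :
    ∃ K : ℝ, ∀ y : ℝ, 0 < y → ‖Hflat H y‖ ≤ K * (Real.sqrt y * y ^ N) := by
  have hA : 0 < A := N.cast_nonneg.trans_lt hN
  obtain ⟨K, hK0, hK⟩ := exists_abs_exp_neg_sub_sum_le N
  set G := axisFourier (plancherelWeight H) with hG
  have hpow : ∀ k : ℕ, (k : ℝ) < A → Integrable fun r : ℝ => (Real.cosh r : ℂ) ^ k * G r := by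
    intro k hk
    refine h.integrable_mul_axisFourier hA.le (by fun_prop) hk (B := 1) fun r => ?_
    rw [norm_pow, Complex.norm_real, Real.norm_eq_abs, abs_of_pos (Real.cosh_pos r), one_mul,
      Real.exp_nat_mul]
    exact pow_le_pow_left₀ (Real.cosh_pos r).le (cosh_le_exp_abs r) k
  refine ⟨K * (2 * Real.pi) ^ N * ∫ r, ‖(Real.cosh r : ℂ) ^ N * G r‖, fun y hy => ?_⟩
  have hx : 0 < 2 * Real.pi * y := by positivity
  have hterm : ∀ k ∈ Finset.range N, Integrable fun r : ℝ =>
      ((-(2 * Real.pi * y : ℝ) : ℂ) ^ k / k.factorial) * ((Real.cosh r : ℂ) ^ k * G r) :=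
    fun k hk => (hpow k (lt_trans (by exact_mod_cast Finset.mem_range.mp hk) hN)).const_mul _
  have hzero : ∫ r : ℝ, ∑ k ∈ Finset.range N,
      ((-(2 * Real.pi * y : ℝ) : ℂ) ^ k / k.factorial) * ((Real.cosh r : ℂ) ^ k * G r) = 0 := by
    rw [integral_finsetSum _ hterm]
    refine Finset.sum_eq_zero fun k hk => ?_
    rw [integral_const_mul, h.integral_cosh_pow_mul_axisFourier
      (fun n _ => plancherelWeight_intCast H n)
      (lt_trans (by exact_mod_cast Finset.mem_range.mp hk) hN), mul_zero]
  have hexpi : Integrable fun r : ℝ =>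
      ((Real.exp (-(2 * Real.pi * y * Real.cosh r)) : ℝ) : ℂ) * G r :=
    (h.integrable_axisFourier hA).bdd_mul (c := Real.exp (-(2 * Real.pi * y)))
      (Continuous.aestronglyMeasurable (by fun_prop))
      (.of_forall fun r => norm_exp_neg_mul_cosh_le hx.le r)
  have h2 : ‖∫ r : ℝ, ((Real.exp (-(2 * Real.pi * y * Real.cosh r)) : ℝ) : ℂ) * G r‖ ≤
      K * (2 * Real.pi * y) ^ N * ∫ r, ‖(Real.cosh r : ℂ) ^ N * G r‖ := by
    rw [← sub_zero (∫ r : ℝ, _ * G r), ← hzero, ← integral_sub hexpi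
      (integrable_finsetSum _ hterm), ← integral_const_mul]
    refine norm_integral_le_of_norm_le ((hpow N hN).norm.const_mul _) (.of_forall fun r => ?_)
    have h3 := hK (2 * Real.pi * y * Real.cosh r) (mul_pos hx (Real.cosh_pos r)).le
    have h4 : ((Real.exp (-(2 * Real.pi * y * Real.cosh r)) : ℝ) : ℂ) * G r -
        ∑ k ∈ Finset.range N,
          ((-(2 * Real.pi * y : ℝ) : ℂ) ^ k / k.factorial) * ((Real.cosh r : ℂ) ^ k * G r) =
        ((Real.exp (-(2 * Real.pi * y * Real.cosh r)) -
          ∑ k ∈ Finset.range N, (-(2 * Real.pi * y * Real.cosh r)) ^ k / k.factorial : ℝ) : ℂ) *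
          G r := by
      rw [ofReal_sub, sub_mul, ofReal_sum, Finset.sum_mul]
      congr 1
      refine Finset.sum_congr rfl fun k _ => ?_
      push_cast
      rw [← neg_mul, mul_pow]
      ring
    rw [h4, norm_mul, Complex.norm_real, Real.norm_eq_abs, norm_mul, norm_pow, Complex.norm_real,
      Real.norm_eq_abs, abs_of_pos (Real.cosh_pos r)]
    calc _ ≤ K * (2 * Real.pi * y * Real.cosh r) ^ N * ‖G r‖ := by gcongr
      _ = _ := by ring
  rw [Hflat_eq_integral hA.le h hy, norm_mul]
  calc _ ≤ Real.sqrt y * (K * (2 * Real.pi * y) ^ N * ∫ r, ‖(Real.cosh r : ℂ) ^ N * G r‖) :=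
      mul_le_mul (norm_sqrt_div_le y) h2 (norm_nonneg _) (Real.sqrt_nonneg y)
    _ = _ := by ring

theorem mellinT_eq_mellin (h : ℝ → ℂ) (w : ℂ) : mellinT h w = mellin h w := by
  simp only [mellinT, mellin, smul_eq_mul, mul_comm]

theorem isBigO_Hflat_atTop {A C : ℝ} {H : ℂ → ℂ} (hA : 0 < A)
    (h : StripDecay A C (plancherelWeight H)) :
    Hflat H =O[Filter.atTop] fun y : ℝ => Real.exp (-1 * y) := by
  obtain ⟨K, hK⟩ := norm_Hflat_le_exp hA h
  refine Asymptotics.IsBigO.of_bound |K| ?_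
  filter_upwards [Filter.eventually_gt_atTop 0] with y hy
  rw [Real.norm_eq_abs, Real.abs_exp]
  refine (hK y hy).trans ?_
  have h1 : Real.sqrt y ≤ Real.exp y := by
    refine le_trans ?_ (Real.add_one_le_exp y)
    rw [Real.sqrt_le_left (by positivity)]
    nlinarith
  have h2 : Real.exp (-(2 * Real.pi * y)) ≤ Real.exp (-2 * y) :=
    Real.exp_le_exp.mpr (by nlinarith [Real.pi_gt_three])
  calc K * (Real.sqrt y * Real.exp (-(2 * Real.pi * y)))
      ≤ |K| * (Real.exp y * Real.exp (-2 * y)) := by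
        gcongr
        exact le_abs_self K
    _ = |K| * Real.exp (-1 * y) := by
        rw [← Real.exp_add]
        ring_nf

theorem isBigO_Hflat_zero {A C : ℝ} {H : ℂ → ℂ}
    (h : StripDecay A C (plancherelWeight H)) {N : ℕ} (hN : (N : ℝ) < A) :
    Hflat H =O[nhdsWithin 0 (Ioi 0)] fun y : ℝ => y ^ (-(-(N + 1 / 2) : ℝ)) := by
  obtain ⟨K, hK⟩ := norm_Hflat_le_pow h hN
  refine Asymptotics.IsBigO.of_bound K ?_
  filter_upwards [self_mem_nhdsWithin] with y hy
  have hy : 0 < y := hy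
  rw [Real.norm_eq_abs, abs_of_pos (Real.rpow_pos_of_pos hy _), neg_neg, Real.rpow_add hy,
    Real.rpow_natCast, ← Real.sqrt_eq_rpow, mul_comm (y ^ N)]
  exact hK y hy

theorem mellinConvergent_Hflat {A C : ℝ} {H : ℂ → ℂ}
    (h : StripDecay A C (plancherelWeight H)) {N : ℕ} (hN : (N : ℝ) < A) {w : ℂ}
    (hw : -(N + 1 / 2 : ℝ) < w.re) : MellinConvergent (Hflat H) w :=
  have hA : 0 < A := N.cast_nonneg.trans_lt hN
  mellinConvergent_of_isBigO_rpow_exp one_pos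
    ((continuousOn_Hflat hA h).locallyIntegrableOn measurableSet_Ioi)
    (isBigO_Hflat_atTop hA h) (isBigO_Hflat_zero h hN) hw

theorem differentiableAt_mellinT_Hflat {A C : ℝ} {H : ℂ → ℂ}
    (h : StripDecay A C (plancherelWeight H)) {N : ℕ} (hN : (N : ℝ) < A) {w : ℂ}
    (hw : -(N + 1 / 2 : ℝ) < w.re) : DifferentiableAt ℂ (mellinT (Hflat H)) w := by
  have hA : 0 < A := N.cast_nonneg.trans_lt hN
  rw [show mellinT (Hflat H) = mellin (Hflat H) from funext (mellinT_eq_mellin _)]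
  exact mellin_differentiableAt_of_isBigO_rpow_exp one_pos
    ((continuousOn_Hflat hA h).locallyIntegrableOn measurableSet_Ioi)
    (isBigO_Hflat_atTop hA h) (isBigO_Hflat_zero h hN) hw

/-- The Mellin transform is bounded on closed vertical strips of absolute convergence. -/
theorem exists_norm_mellin_le {f : ℝ → ℂ} {σ₁ σ₂ : ℝ}
    (h₁ : MellinConvergent f σ₁) (h₂ : MellinConvergent f σ₂) :
    ∃ M : ℝ, 0 ≤ M ∧ ∀ w : ℂ, σ₁ ≤ w.re → w.re ≤ σ₂ → ‖mellin f w‖ ≤ M := by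
  refine ⟨∫ y in Ioi (0 : ℝ), (‖(y : ℂ) ^ ((σ₁ : ℂ) - 1) • f y‖ + ‖(y : ℂ) ^ ((σ₂ : ℂ) - 1) • f y‖),
    integral_nonneg fun y => by positivity, fun w hw₁ hw₂ => ?_⟩
  refine norm_integral_le_of_norm_le (h₁.norm.add h₂.norm) ?_
  refine (ae_restrict_mem measurableSet_Ioi).mono fun y hy => ?_
  have hy : 0 < y := hy
  rw [norm_smul, norm_smul, norm_smul, ← add_mul]
  refine mul_le_mul_of_nonneg_right ?_ (norm_nonneg _)
  simp only [norm_cpow_eq_rpow_re_of_pos hy, sub_re, ofReal_re, one_re]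
  rcases le_total y 1 with h | h
  · exact (Real.rpow_le_rpow_of_exponent_ge hy h (by linarith)).trans
      (le_add_of_nonneg_right (Real.rpow_nonneg hy.le _))
  · exact (Real.rpow_le_rpow_of_exponent_le h (by linarith)).trans
      (le_add_of_nonneg_left (Real.rpow_nonneg hy.le _))

theorem cpow_inv_two_mul_cosh (ν : ℂ) (r : ℝ) :
    ((1 / (2 * Real.cosh r) : ℝ) : ℂ) ^ ν = betaKernel (ν / 2) (ν / 2) (2 * r) := by
  have hc := Real.cosh_pos r
  have hx : 0 < 1 / (2 * Real.cosh r) := by positivity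
  have e1 : Real.sigmoid (2 * r) = Real.exp r * (1 / (2 * Real.cosh r)) := by
    rw [Real.sigmoid_def, Real.cosh_eq, show -(2 * r) = -r + -r by ring, Real.exp_add,
      Real.exp_neg]
    field_simp
  have e2 : 1 - Real.sigmoid (2 * r) = Real.exp (-r) * (1 / (2 * Real.cosh r)) := by
    rw [e1, Real.cosh_eq]
    have := Real.exp_pos r
    have := Real.exp_pos (-r)
    field_simp
    ring
  rw [betaKernel, e2, e1, cpow_def_of_ne_zero (by exact_mod_cast hx.ne'),
    cpow_def_of_ne_zero (by exact_mod_cast (by positivity : Real.exp r * _ ≠ 0)),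
    cpow_def_of_ne_zero (by exact_mod_cast (by positivity : Real.exp (-r) * _ ≠ 0)),
    ← ofReal_log hx.le, ← ofReal_log (by positivity), ← ofReal_log (by positivity),
    Real.log_mul (Real.exp_pos _).ne' hx.ne', Real.log_mul (Real.exp_pos _).ne' hx.ne',
    Real.log_exp, Real.log_exp, ← Complex.exp_add]
  congr 1
  push_cast
  ring

theorem integral_exp_mul_cpow_cosh {ν : ℂ} (hν : 0 < ν.re) (t : ℝ) :
    ∫ r : ℝ, Complex.exp (r * t * I) * ((1 / (2 * Real.cosh r) : ℝ) : ℂ) ^ ν =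
      Complex.Gamma ((ν + t * I) / 2) * Complex.Gamma ((ν - t * I) / 2) /
        (2 * Complex.Gamma ν) := by
  have h1 : ∀ r : ℝ, Complex.exp (r * t * I) * ((1 / (2 * Real.cosh r) : ℝ) : ℂ) ^ ν =
      betaKernel ((ν + t * I) / 2) ((ν - t * I) / 2) (2 * r) := by
    intro r
    rw [cpow_inv_two_mul_cosh, show (r * t * I : ℂ) = t * I / 2 * ((2 * r : ℝ) : ℂ) by
      push_cast; ring, exp_mul_betaKernel]
    congr 1 <;> ring
  simp_rw [h1]
  rw [Measure.integral_comp_mul_left (betaKernel ((ν + t * I) / 2) ((ν - t * I) / 2)) 2,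
    integral_betaKernel (by simpa using hν) (by simpa using hν)]
  rw [show (ν + t * I) / 2 + (ν - t * I) / 2 = ν by ring]
  simp
  ring

theorem integrable_cpow_cosh {ν : ℂ} (hν : 0 < ν.re) :
    Integrable fun r : ℝ => ((1 / (2 * Real.cosh r) : ℝ) : ℂ) ^ ν := by
  simp_rw [cpow_inv_two_mul_cosh]
  exact (integrable_betaKernel (by simpa using hν) (by simpa using hν)).comp_mul_left' two_ne_zero

theorem integral_cpow_cosh_mul_axisFourier {A C : ℝ} {g : ℂ → ℂ} (hA : 0 ≤ A)
    (h : StripDecay A C g) {ν : ℂ} (hν : 0 < ν.re) :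
    ∫ r : ℝ, ((1 / (2 * Real.cosh r) : ℝ) : ℂ) ^ ν * axisFourier g r =
      1 / (2 * Complex.Gamma ν) * ∫ t : ℝ,
        g (t * I) * (Complex.Gamma ((ν + t * I) / 2) * Complex.Gamma ((ν - t * I) / 2)) := by
  have hInt : Integrable (Function.uncurry fun (r t : ℝ) =>
      Complex.exp (r * t * I) * (((1 / (2 * Real.cosh r) : ℝ) : ℂ) ^ ν * g (t * I)))
      (volume.prod volume) := by
    refine ((integrable_cpow_cosh hν).mul_prod (h.integrable_axis hA)).bdd_mul (c := 1)
      (Continuous.aestronglyMeasurable (by fun_prop)) (.of_forall fun p => ?_)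
    simp [Complex.norm_exp]
  have h1 : ∀ r : ℝ, ((1 / (2 * Real.cosh r) : ℝ) : ℂ) ^ ν * axisFourier g r =
      ∫ t : ℝ, Complex.exp (r * t * I) * (((1 / (2 * Real.cosh r) : ℝ) : ℂ) ^ ν * g (t * I)) := by
    intro r
    rw [axisFourier, ← integral_const_mul]
    congr 1 with t
    ring
  simp_rw [h1]
  rw [integral_integral_swap hInt, ← integral_const_mul]
  congr 1 with t
  simp_rw [← mul_assoc]
  rw [integral_mul_const, integral_exp_mul_cpow_cosh hν]
  ring

theorem mellinT_Hflat_eq {A C : ℝ} {H : ℂ → ℂ} (hA : 0 < A)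
    (h : StripDecay A C (plancherelWeight H)) {w : ℂ} (hw : -(1 / 2) < w.re) :
    mellinT (Hflat H) w = 1 / (8 * Real.pi) * (Real.pi : ℂ) ^ (-(w + 1 / 2)) *
      ∫ t : ℝ, plancherelWeight H (t * I) *
        (Complex.Gamma ((w + 1 / 2 + t * I) / 2) * Complex.Gamma ((w + 1 / 2 - t * I) / 2)) := by
  set ν := w + 1 / 2 with hνdef
  have hν : 0 < ν.re := by
    simp [hνdef]
    linarith
  set G := axisFourier (plancherelWeight H) with hG
  have hGc : Continuous G := h.continuous_axisFourier hA.le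
  have h1 : ∀ y ∈ Ioi (0 : ℝ), Hflat H y * (y : ℂ) ^ (w - 1) =
      1 / (4 * Real.pi) * ∫ r : ℝ, (y : ℂ) ^ (ν - 1) *
        ((Real.exp (-(2 * Real.pi * y * Real.cosh r)) : ℝ) : ℂ) * G r := by
    intro y hy
    have hy : 0 < y := hy
    have hsq : (Real.sqrt y : ℂ) * (y : ℂ) ^ (w - 1) = (y : ℂ) ^ (ν - 1) := by
      rw [Real.sqrt_eq_rpow, ofReal_cpow hy.le, ← cpow_add _ _ (by exact_mod_cast hy.ne'), hνdef]
      congr 1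
      push_cast
      ring
    simp_rw [mul_assoc ((y : ℂ) ^ (ν - 1))]
    rw [Hflat_eq_integral hA.le h hy, integral_const_mul, ← hsq]
    ring
  have hInt : Integrable (Function.uncurry fun (y r : ℝ) => (y : ℂ) ^ (ν - 1) *
      ((Real.exp (-(2 * Real.pi * y * Real.cosh r)) : ℝ) : ℂ) * G r)
      ((volume.restrict (Ioi 0)).prod volume) := by
    have hy : IntegrableOn (fun y : ℝ => y ^ (ν.re - 1) * Real.exp (-(2 * Real.pi * y))) (Ioi 0) := by
      have := integrableOn_rpow_mul_exp_neg_mul_rpow (s := ν.re - 1) (p := 1) (b := 2 * Real.pi)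
        (by linarith) one_pos (by positivity)
      simpa using this
    refine (hy.mul_prod (h.integrable_axisFourier hA).norm).mono' ?_ ?_
    · have : Measurable G := hGc.measurable
      refine Measurable.aestronglyMeasurable ?_
      unfold Function.uncurry
      fun_prop
    · have hpos : ∀ᵐ p : ℝ × ℝ ∂((volume.restrict (Ioi 0)).prod volume), 0 < p.1 :=
        Measure.quasiMeasurePreserving_fst.ae (ae_restrict_mem measurableSet_Ioi)
      filter_upwards [hpos] with p hp
      rw [Function.uncurry, norm_mul, norm_mul, norm_cpow_eq_rpow_re_of_pos hp]
      simp only [sub_re, one_re]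
      gcongr
      exact norm_exp_neg_mul_cosh_le (by positivity) p.2
  rw [mellinT, setIntegral_congr_fun measurableSet_Ioi h1, integral_const_mul,
    integral_integral_swap hInt]
  have h2 : ∀ r : ℝ, ∫ y in Ioi (0 : ℝ), (y : ℂ) ^ (ν - 1) *
      ((Real.exp (-(2 * Real.pi * y * Real.cosh r)) : ℝ) : ℂ) * G r =
      (Real.pi : ℂ) ^ (-ν) * Complex.Gamma ν *
        (((1 / (2 * Real.cosh r) : ℝ) : ℂ) ^ ν * G r) := by
    intro r
    have hc := Real.cosh_pos r
    have h3 : ((1 : ℂ) / ((2 * Real.pi * Real.cosh r : ℝ) : ℂ)) ^ ν =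
        (Real.pi : ℂ) ^ (-ν) * ((1 / (2 * Real.cosh r) : ℝ) : ℂ) ^ ν := by
      rw [cpow_neg, ← inv_cpow _ _ (by
        rw [arg_ofReal_of_nonneg Real.pi_pos.le]; exact Real.pi_pos.ne), ← ofReal_inv,
        ← mul_cpow_ofReal_nonneg (by positivity) (by positivity)]
      congr 1
      push_cast
      field_simp
    have h4 := Complex.integral_cpow_mul_exp_neg_mul_Ioi hν
      (r := 2 * Real.pi * Real.cosh r) (by positivity)
    rw [integral_mul_const, mul_comm ((Real.pi : ℂ) ^ (-ν)), mul_assoc, ← mul_assoc (_ ^ (-ν)),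
      ← h3, ← mul_assoc, mul_comm (Complex.Gamma ν), ← h4]
    congr 1
    refine integral_congr_ae (.of_forall fun y => ?_)
    dsimp only
    push_cast
    ring_nf
  simp_rw [h2]
  rw [integral_const_mul, integral_cpow_cosh_mul_axisFourier hA.le h hν]
  generalize (∫ t : ℝ, _ : ℂ) = J
  have := Complex.Gamma_ne_zero_of_re_pos hν
  field_simp
  ring

/-- Uniform bound for a quotient of Gamma functions, from the Beta integral. -/
theorem norm_Gamma_div_Gamma_add_le {σ : ℝ} (hσ : 0 < σ) {p q : ℂ} (hp : σ ≤ p.re)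
    (hq : 0 < q.re) :
    ‖Complex.Gamma p / Complex.Gamma (p + q)‖ ≤
      (∫ r, ‖betaKernel σ q r‖) / ‖Complex.Gamma q‖ := by
  have hΓ := Complex.Gamma_ne_zero_of_re_pos hq
  have h1 : Complex.Gamma p / Complex.Gamma (p + q) = (∫ r, betaKernel p q r) / Complex.Gamma q := by
    rw [integral_betaKernel (hσ.trans_le hp) hq]
    field_simp
  rw [h1, norm_div]
  gcongr
  refine norm_integral_le_of_norm_le
    (integrable_betaKernel (p := σ) (by simpa using hσ) hq).norm (.of_forall fun r => ?_)
  have h0 := Real.sigmoid_pos r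
  rw [betaKernel, betaKernel, norm_mul, norm_mul, norm_cpow_eq_rpow_re_of_pos h0,
    norm_cpow_eq_rpow_re_of_pos h0, ofReal_re]
  refine mul_le_mul_of_nonneg_right ?_ (norm_nonneg _)
  exact Real.rpow_le_rpow_of_exponent_ge h0 (Real.sigmoid_lt_one r).le hp

/-- The quotient of Gamma functions left in the outer integral of the off-diagonal transform. -/
noncomputable def gammaQuotient (α : Fin 3 → ℂ) (s z : ℂ) : ℂ :=
  (∏ i, Complex.Gamma ((z + 1) / 2 - s + α i / 2)) / Complex.Gamma (z / 2 + 3 / 2 - 2 * s)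

section

variable {α : Fin 3 → ℂ} {s : ℂ}

theorem differentiableAt_gammaQuotient (hre : ∀ i, (α i).re = 0) (hs₂ : s.re < 1) {z : ℂ}
    (hz : 2 * s.re - 1 < z.re) : DifferentiableAt ℂ (gammaQuotient α s) z := by
  have hd : 0 < (z / 2 + 3 / 2 - 2 * s).re := by
    simp
    linarith
  have hn : ∀ i, 0 < ((z + 1) / 2 - s + α i / 2).re := fun i => by
    simp [hre]
    linarith
  unfold gammaQuotient
  simp only [Fin.prod_univ_three]
  have key : ∀ i, DifferentiableAt ℂ (fun z => Complex.Gamma ((z + 1) / 2 - s + α i / 2)) z :=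
    fun i => (differentiableAt_Gamma_of_re_pos (hn i)).comp z
      (f := fun z => (z + 1) / 2 - s + α i / 2) (by fun_prop)
  refine (((key 0).mul (key 1)).mul (key 2)).div ?_ (Complex.Gamma_ne_zero_of_re_pos hd)
  exact (differentiableAt_Gamma_of_re_pos hd).comp z
    (f := fun z => z / 2 + 3 / 2 - 2 * s) (by fun_prop)

theorem inv_one_add_sq_half_add_le (y τ : ℝ) :
    (1 + (y / 2 + τ) ^ 2)⁻¹ ≤ 8 * (1 + τ ^ 2) * (1 + y ^ 2)⁻¹ := by
  rw [← div_eq_mul_inv, inv_le_comm₀ (by positivity) (by positivity), inv_div,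
    div_le_iff₀ (by positivity)]
  nlinarith [sq_nonneg (y / 2 + 2 * τ), sq_nonneg (τ * (y / 2 + τ))]

theorem exists_norm_gammaQuotient_le (hre : ∀ i, (α i).re = 0) (hs₂ : s.re < 1) {a b : ℝ}
    (ha : 2 * s.re - 1 < a) :
    ∃ K : ℝ, 0 ≤ K ∧ ∀ z : ℂ, a ≤ z.re → z.re ≤ b →
      ‖gammaQuotient α s z‖ ≤ K * (1 + z.im ^ 2)⁻¹ := by
  obtain ⟨C, hC0, hC⟩ := exists_norm_Gamma_le (σ₁ := (a + 1) / 2 - s.re)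
    (σ₂ := (b + 1) / 2 - s.re) (by linarith)
  have hD : 0 < (1 - s - α 0 / 2).re := by
    simp [hre]
    linarith
  set B := (∫ r, ‖betaKernel ((a + 1) / 2 - s.re : ℝ) (1 - s - α 0 / 2) r‖) /
    ‖Complex.Gamma (1 - s - α 0 / 2)‖
  have hB : 0 ≤ B := div_nonneg (integral_nonneg fun r => norm_nonneg _) (norm_nonneg _)
  set τ := (-s + α 2 / 2).im with hτ
  refine ⟨B * C * (C * (8 * (1 + τ ^ 2))), by positivity, fun z hz₁ hz₂ => ?_⟩
  have hp : ∀ i, ((z + 1) / 2 - s + α i / 2).re = (z.re + 1) / 2 - s.re := fun i => by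
    simp [hre]
  have h0 := norm_Gamma_div_Gamma_add_le (σ := (a + 1) / 2 - s.re) (by linarith)
    (p := (z + 1) / 2 - s + α 0 / 2) (by rw [hp]; linarith) hD
  have h1 := hC ((z + 1) / 2 - s + α 1 / 2) (by rw [hp]; linarith) (by rw [hp]; linarith)
  have h2 := hC ((z + 1) / 2 - s + α 2 / 2) (by rw [hp]; linarith) (by rw [hp]; linarith)
  have him : ((z + 1) / 2 - s + α 2 / 2).im = z.im / 2 + τ := by
    simp [hτ]
    ring
  have h1' : ‖Complex.Gamma ((z + 1) / 2 - s + α 1 / 2)‖ ≤ C := by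
    refine h1.trans (mul_le_of_le_one_right hC0 (inv_le_one_of_one_le₀ ?_))
    nlinarith [sq_nonneg ((z + 1) / 2 - s + α 1 / 2).im]
  have h2' : ‖Complex.Gamma ((z + 1) / 2 - s + α 2 / 2)‖ ≤
      C * (8 * (1 + τ ^ 2) * (1 + z.im ^ 2)⁻¹) := by
    refine h2.trans (mul_le_mul_of_nonneg_left ?_ hC0)
    rw [him]
    exact inv_one_add_sq_half_add_le _ _
  have heq : gammaQuotient α s z = Complex.Gamma ((z + 1) / 2 - s + α 0 / 2) /
      Complex.Gamma ((z + 1) / 2 - s + α 0 / 2 + (1 - s - α 0 / 2)) *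
      Complex.Gamma ((z + 1) / 2 - s + α 1 / 2) * Complex.Gamma ((z + 1) / 2 - s + α 2 / 2) := by
    rw [gammaQuotient, Fin.prod_univ_three, show (z + 1) / 2 - s + α 0 / 2 + (1 - s - α 0 / 2) =
      z / 2 + 3 / 2 - 2 * s by ring]
    ring
  rw [heq, norm_mul, norm_mul]
  calc _ ≤ B * C * (C * (8 * (1 + τ ^ 2) * (1 + z.im ^ 2)⁻¹)) := by gcongr
    _ = _ := by ring

theorem integrable_gammaQuotient (hre : ∀ i, (α i).re = 0) (hs₂ : s.re < 1) {c : ℝ}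
    (hc : 2 * s.re - 1 < c) : Integrable fun t : ℝ => gammaQuotient α s (c + t * I) := by
  obtain ⟨K, -, hK⟩ := exists_norm_gammaQuotient_le (b := c) hre hs₂ hc
  refine integrable_of_norm_le_inv_one_add_sq (C := K) ?_ fun t => ?_
  · refine continuous_iff_continuousAt.mpr fun t => ?_
    exact ContinuousAt.comp (f := fun t : ℝ => (c : ℂ) + t * I)
      (differentiableAt_gammaQuotient hre hs₂ (by simpa using hc)).continuousAt (by fun_prop)
  · simpa using hK (c + t * I) (by simp) (by simp)

/-- The inner integral, evaluated by the second Barnes lemma. -/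
theorem integral_inner_eq (hre : ∀ i, (α i).re = 0) (hsum : α 0 + α 1 + α 2 = 0)
    (hs₁ : 1 / 2 + 1 / 100 < s.re) {s₁ : ℂ} (hs : 4 * s.re - 2 < s₁.re) :
    ∫ v : ℝ, Complex.Gamma ((1 / 100 + v * I) / 2) *
        Complex.Gamma ((s₁ - (2 * s - 1) + (1 / 100 + v * I)) / 2 + 1 / 2 - s) *
        (∏ i, Complex.Gamma ((2 * s - 1 - (1 / 100 + v * I) + α i) / 2)) /
        Complex.Gamma ((2 * s - 1 - (1 / 100 + v * I) + s₁) / 2) =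
      4 * Real.pi * (∏ i, Complex.Gamma (s - 1 / 2 + α i / 2)) *
        (∏ i, Complex.Gamma ((s₁ + 1) / 2 - s + α i / 2)) /
        ∏ i, Complex.Gamma ((s₁ - α i) / 2) := by
  have hα : α 2 = -α 0 - α 1 := by linear_combination hsum
  have ha : ∀ i, 0 < (s - 1 / 2 + α i / 2 - 1 / 200).re := fun i => by
    simp [hre]
    linarith
  have hB := barnes_second_lemma (ha 0) (ha 1) (ha 2) (d := 1 / 200)
    (e := s₁ / 2 + 1 - 2 * s + 1 / 200) (by norm_num) (by simp; linarith)
  set f : ℝ → ℂ := fun v => Complex.Gamma ((1 / 100 + v * I) / 2) *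
        Complex.Gamma ((s₁ - (2 * s - 1) + (1 / 100 + v * I)) / 2 + 1 / 2 - s) *
        (∏ i, Complex.Gamma ((2 * s - 1 - (1 / 100 + v * I) + α i) / 2)) /
        Complex.Gamma ((2 * s - 1 - (1 / 100 + v * I) + s₁) / 2) with hf
  have h2 : ∫ v, f v = 2 * ∫ x, f (-2 * x) := by
    rw [Measure.integral_comp_mul_left f (-2)]
    simp
  rw [h2]
  simp only [hf, Fin.prod_univ_three]
  have h3 : ∀ x y : ℂ, x = y → 2 * x = 2 * y := fun x y h => by rw [h]
  refine (h3 _ _ ((integral_congr_ae (.of_forall fun x => ?_)).trans hB)).trans ?_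
  · rw [hα]
    push_cast
    ring_nf
  · rw [hα]
    ring_nf

/-- The integral over the remaining vertical line, evaluated by the second Barnes lemma. -/
theorem integral_gammaQuotient_mul_Gamma (hre : ∀ i, (α i).re = 0) (hsum : α 0 + α 1 + α 2 = 0)
    {c : ℝ} (hc : 2 * s.re - 1 < c) (hc' : c < s.re) (t : ℝ) :
    ∫ t₁ : ℝ, gammaQuotient α s (c + t₁ * I) *
        (Complex.Gamma ((s - (c + t₁ * I) + t * I) / 2) *
          Complex.Gamma ((s - (c + t₁ * I) - t * I) / 2)) =
      4 * Real.pi * (∏ i, Complex.Gamma ((1 - s + α i + t * I) / 2) *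
        Complex.Gamma ((1 - s + α i - t * I) / 2)) / ∏ i, Complex.Gamma (1 - s - α i / 2) := by
  have hα : α 2 = -α 0 - α 1 := by linear_combination hsum
  have ha : ∀ i, 0 < ((c + 1) / 2 - s + α i / 2).re := fun i => by
    simp [hre]
    linarith
  have hB := barnes_second_lemma (ha 0) (ha 1) (ha 2) (d := (s - c + t * I) / 2)
    (e := (s - c - t * I) / 2) (by simp; linarith) (by simp; linarith)
  set f : ℝ → ℂ := fun t₁ => gammaQuotient α s (c + t₁ * I) *
        (Complex.Gamma ((s - (c + t₁ * I) + t * I) / 2) *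
          Complex.Gamma ((s - (c + t₁ * I) - t * I) / 2)) with hf
  have h2 : ∫ v, f v = 2 * ∫ x, f (2 * x) := by
    rw [Measure.integral_comp_mul_left f 2]
    simp
  rw [h2]
  simp only [hf, gammaQuotient, Fin.prod_univ_three]
  have h3 : ∀ x y : ℂ, x = y → 2 * x = 2 * y := fun x y h => by rw [h]
  refine (h3 _ _ ((integral_congr_ae (.of_forall fun x => ?_)).trans hB)).trans ?_
  · rw [hα]
    push_cast
    ring_nf
  · rw [hα]
    ring_nf

/-- Moving the line of integration to the range where `mellinT_Hflat_eq` applies. -/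
theorem integral_mellinT_mul_gammaQuotient_shift {A C : ℝ} {H : ℂ → ℂ}
    (h : StripDecay A C (plancherelWeight H)) {N : ℕ} (hN : (N : ℝ) < A)
    (hre : ∀ i, (α i).re = 0) (hs₂ : s.re < 1) {a b : ℝ} (ha : 2 * s.re - 1 < a) (ha0 : 0 ≤ a)
    (hab : a ≤ b) (hb : b < N + s.re) :
    ∫ t : ℝ, mellinT (Hflat H) (s - (a + t * I) - 1 / 2) * (Real.pi : ℂ) ^ (-(a + t * I)) *
        gammaQuotient α s (a + t * I) =
      ∫ t : ℝ, mellinT (Hflat H) (s - (b + t * I) - 1 / 2) * (Real.pi : ℂ) ^ (-(b + t * I)) *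
        gammaQuotient α s (b + t * I) := by
  obtain ⟨K, hK0, hK⟩ := exists_norm_gammaQuotient_le (b := b) hre hs₂ ha
  obtain ⟨M, hM0, hM⟩ := exists_norm_mellin_le (f := Hflat H)
    (σ₁ := s.re - b - 1 / 2) (σ₂ := s.re - a - 1 / 2)
    (mellinConvergent_Hflat h hN (by rw [ofReal_re]; linarith))
    (mellinConvergent_Hflat h hN (by rw [ofReal_re]; linarith))
  have hw : ∀ z : ℂ, (s - z - 1 / 2).re = s.re - z.re - 1 / 2 := fun z => by simp
  refine integral_vertical_line_eq (C := M * 1 * K) (f := fun z => mellinT (Hflat H) (s - z - 1 / 2) *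
    (Real.pi : ℂ) ^ (-z) * gammaQuotient α s z) hab (fun z hz₁ hz₂ => ?_) fun z hz₁ hz₂ => ?_
  · refine DifferentiableAt.mul (DifferentiableAt.mul ?_ ?_)
      (differentiableAt_gammaQuotient hre hs₂ (by linarith))
    · exact (differentiableAt_mellinT_Hflat h hN (by rw [hw]; linarith)).comp z
        (f := fun z => s - z - 1 / 2) (by fun_prop)
    · exact DifferentiableAt.const_cpow (by fun_prop) (.inl (by exact_mod_cast Real.pi_ne_zero))
  · rw [norm_mul, norm_mul, mul_assoc (M * 1)]
    have h1 : ‖(Real.pi : ℂ) ^ (-z)‖ ≤ 1 := by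
      rw [norm_cpow_eq_rpow_re_of_pos Real.pi_pos]
      exact Real.rpow_le_one_of_one_le_of_nonpos (by linarith [Real.pi_gt_three])
        (by rw [neg_re]; linarith)
    have h2 : ‖mellinT (Hflat H) (s - z - 1 / 2)‖ ≤ M := by
      rw [mellinT_eq_mellin]
      exact hM _ (by rw [hw]; linarith) (by rw [hw]; linarith)
    have := hK z hz₁ hz₂
    gcongr

theorem integral_mellinT_mul_gammaQuotient {A C : ℝ} {H : ℂ → ℂ} (hA : 0 < A)
    (h : StripDecay A C (plancherelWeight H)) (hre : ∀ i, (α i).re = 0)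
    (hsum : α 0 + α 1 + α 2 = 0) (hs₂ : s.re < 1) {c : ℝ} (hc : 2 * s.re - 1 < c)
    (hc' : c < s.re) :
    ∫ t₁ : ℝ, mellinT (Hflat H) (s - (c + t₁ * I) - 1 / 2) * (Real.pi : ℂ) ^ (-(c + t₁ * I)) *
        gammaQuotient α s (c + t₁ * I) =
      1 / 2 * (Real.pi : ℂ) ^ (-s) / (∏ i, Complex.Gamma (1 - s - α i / 2)) *
        ∫ t : ℝ, plancherelWeight H (t * I) *
          ∏ i, Complex.Gamma ((1 - s + α i + t * I) / 2) *
            Complex.Gamma ((1 - s + α i - t * I) / 2) := by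
  have hpi : (Real.pi : ℂ) ≠ 0 := by exact_mod_cast Real.pi_ne_zero
  set F : ℝ → ℝ → ℂ := fun t₁ t =>
    (Complex.Gamma ((s - (c + t₁ * I) + t * I) / 2) *
      Complex.Gamma ((s - (c + t₁ * I) - t * I) / 2)) *
      (gammaQuotient α s (c + t₁ * I) * plancherelWeight H (t * I)) with hF
  have h1 : ∀ t₁ : ℝ, mellinT (Hflat H) (s - (c + t₁ * I) - 1 / 2) *
      (Real.pi : ℂ) ^ (-(c + t₁ * I)) * gammaQuotient α s (c + t₁ * I) =
      1 / (8 * Real.pi) * (Real.pi : ℂ) ^ (-s) * ∫ t : ℝ, F t₁ t := by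
    intro t₁
    rw [mellinT_Hflat_eq hA h (by simp; linarith), sub_add_cancel]
    have hpow : (Real.pi : ℂ) ^ (-s) = (Real.pi : ℂ) ^ (-(s - (c + t₁ * I))) *
        (Real.pi : ℂ) ^ (-(c + t₁ * I)) := by
      rw [← cpow_add _ _ hpi]
      ring_nf
    have hFt : ∫ t : ℝ, F t₁ t = gammaQuotient α s (c + t₁ * I) *
        ∫ t : ℝ, plancherelWeight H (t * I) *
          (Complex.Gamma ((s - (c + t₁ * I) + t * I) / 2) *
            Complex.Gamma ((s - (c + t₁ * I) - t * I) / 2)) := by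
      rw [← integral_const_mul]
      refine integral_congr_ae (.of_forall fun t => ?_)
      simp only [hF]
      ring
    rw [hFt, hpow]
    ring
  have hInt : Integrable (Function.uncurry F) (volume.prod volume) := by
    have hpos : 0 < (s.re - c) / 2 := by linarith
    have hre₁ : ∀ p : ℝ × ℝ, ((s - (c + p.1 * I) + p.2 * I) / 2).re = (s.re - c) / 2 := by simp
    have hre₂ : ∀ p : ℝ × ℝ, ((s - (c + p.1 * I) - p.2 * I) / 2).re = (s.re - c) / 2 := by simp
    refine ((integrable_gammaQuotient hre hs₂ hc).mul_prod (h.integrable_axis hA.le)).bdd_mul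
      (c := Real.Gamma ((s.re - c) / 2) * Real.Gamma ((s.re - c) / 2)) ?_ (.of_forall fun p => ?_)
    · exact ((continuous_Gamma_comp (by fun_prop) fun p => by rw [hre₁]; exact hpos).mul
        (continuous_Gamma_comp (by fun_prop) fun p => by rw [hre₂]; exact hpos)).aestronglyMeasurable
    · rw [norm_mul]
      have e1 := norm_Gamma_le_Gamma_re (z := (s - (c + p.1 * I) + p.2 * I) / 2)
        (by rw [hre₁]; exact hpos)
      have e2 := norm_Gamma_le_Gamma_re (z := (s - (c + p.1 * I) - p.2 * I) / 2)
        (by rw [hre₂]; exact hpos)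
      rw [hre₁] at e1
      rw [hre₂] at e2
      gcongr
  simp_rw [h1]
  rw [integral_const_mul, integral_integral_swap hInt, ← integral_const_mul, ← integral_const_mul]
  refine integral_congr_ae (.of_forall fun t => ?_)
  dsimp only
  have h2 : ∫ t₁ : ℝ, F t₁ t = (∫ t₁ : ℝ, gammaQuotient α s (c + t₁ * I) *
        (Complex.Gamma ((s - (c + t₁ * I) + t * I) / 2) *
          Complex.Gamma ((s - (c + t₁ * I) - t * I) / 2))) * plancherelWeight H (t * I) := by
    rw [← integral_mul_const]
    refine integral_congr_ae (.of_forall fun t₁ => ?_)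
    simp only [hF]
    ring
  rw [h2, integral_gammaQuotient_mul_Gamma hre hsum hc hc']
  generalize (∏ i, Complex.Gamma (1 - s - α i / 2)) = X
  field_simp
  ring

end

/-- Explicit evaluation of the off-diagonal main-term transform (Theorem 1.2 /
Theorem 9.2 of the paper). -/
theorem offdiagonal_main_term_evaluation (η : ℝ) (hη : 40 < η)
    (H : ℂ → ℂ) (hH : MemCeta η H)
    (α : Fin 3 → ℂ) (hre : ∀ i, (α i).re = 0) (hsum : α 0 + α 1 + α 2 = 0)
    (s : ℂ) (hs₁ : 1/2 + 1/100 < s.re) (hs₂ : s.re < 1) :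
    FtransMain η α H (2 * s - 1) s =
      (Real.pi : ℂ) ^ (1/2 - s) *
        (∏ i, Complex.Gamma (s - 1/2 + α i / 2) / Complex.Gamma (1 - s - α i / 2)) *
        ((1 / (2 * (Real.pi : ℂ))) * ∫ t : ℝ,
          (H (t * I) / (Complex.Gamma (t * I) * Complex.Gamma (-(t * I)))) *
            ∏ i, Complex.Gamma ((1 - s + α i + t * I) / 2) *
              Complex.Gamma ((1 - s + α i - t * I) / 2)) := by
  have hN : (⌈η⌉₊ : ℝ) < η + 1 := Nat.ceil_lt_add_one (by linarith)
  obtain ⟨C, hg⟩ := stripDecay_plancherelWeight (A := η + 1) hH (by linarith) (by linarith)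
  have hpi : (Real.pi : ℂ) ≠ 0 := by exact_mod_cast Real.pi_ne_zero
  have hinner : ∀ t₁ : ℝ, (∫ v : ℝ,
      let s1 : ℂ := ((η : ℝ) - 1/2 : ℝ) + t₁ * Complex.I
      let u : ℂ := 1/100 + v * Complex.I
      mellinT (Hflat H) (s - s1 - 1/2) * (Real.pi : ℂ) ^ (-s1) *
        ((∏ i, Complex.Gamma ((s1 - α i) / 2)) / Complex.Gamma ((1 + s1) / 2 - (2 * s - 1))) *
        (Complex.Gamma (u / 2) * Complex.Gamma ((s1 - (2 * s - 1) + u) / 2 + 1/2 - s) *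
          (∏ i, Complex.Gamma ((2 * s - 1 - u + α i) / 2)) *
            Complex.Gamma (s - (2 * s - 1 + u) / 2)) /
        (Complex.Gamma ((1 - u) / 2) * Complex.Gamma ((2 * s - 1 - u + s1) / 2))) =
      4 * Real.pi * (∏ i, Complex.Gamma (s - 1 / 2 + α i / 2)) *
        (mellinT (Hflat H) (s - (((η - 1 / 2 : ℝ) : ℂ) + t₁ * I) - 1 / 2) *
          (Real.pi : ℂ) ^ (-(((η - 1 / 2 : ℝ) : ℂ) + t₁ * I)) *
          gammaQuotient α s (((η - 1 / 2 : ℝ) : ℂ) + t₁ * I)) := by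
    intro t₁
    dsimp only
    set s₁ : ℂ := ((η - 1 / 2 : ℝ) : ℂ) + t₁ * I with hs₁def
    have hs₁re : s₁.re = η - 1 / 2 := by simp [hs₁def]
    have hne : (∏ i, Complex.Gamma ((s₁ - α i) / 2)) ≠ 0 :=
      Finset.prod_ne_zero_iff.mpr fun i _ => Complex.Gamma_ne_zero_of_re_pos (by
        rw [div_ofNat_re, sub_re, hre, hs₁re]
        linarith)
    have hv : ∀ v : ℝ, Complex.Gamma ((1 - (1 / 100 + v * I)) / 2) ≠ 0 := fun v =>
      Complex.Gamma_ne_zero_of_re_pos (by norm_num)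
    have h1 := integral_inner_eq hre hsum hs₁ (s₁ := s₁) (by rw [hs₁re]; linarith)
    rw [gammaQuotient, show s₁ / 2 + 3 / 2 - 2 * s = (1 + s₁) / 2 - (2 * s - 1) by ring]
    have h2 : ∀ X Y D : ℂ, 4 * Real.pi * (∏ i, Complex.Gamma (s - 1 / 2 + α i / 2)) *
        (X * Y * ((∏ i, Complex.Gamma ((s₁ + 1) / 2 - s + α i / 2)) / D)) =
        X * Y * ((∏ i, Complex.Gamma ((s₁ - α i) / 2)) / D) *
        (4 * Real.pi * (∏ i, Complex.Gamma (s - 1 / 2 + α i / 2)) *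
        (∏ i, Complex.Gamma ((s₁ + 1) / 2 - s + α i / 2)) /
        ∏ i, Complex.Gamma ((s₁ - α i) / 2)) := by
      intro X Y D
      field_simp
    rw [h2, ← h1, ← integral_const_mul]
    refine integral_congr_ae (.of_forall fun v => ?_)
    dsimp only
    rw [show s - (2 * s - 1 + (1 / 100 + v * I)) / 2 = (1 - (1 / 100 + v * I)) / 2 by ring]
    have := hv v
    rw [mul_comm (Complex.Gamma ((1 - (1 / 100 + v * I)) / 2)) (Complex.Gamma _), mul_div_assoc,
      mul_div_mul_right _ _ this]
  have hηceil := Nat.le_ceil η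
  have hprod : (∏ i, Complex.Gamma (s - 1/2 + α i / 2) / Complex.Gamma (1 - s - α i / 2)) =
      (∏ i, Complex.Gamma (s - 1/2 + α i / 2)) / ∏ i, Complex.Gamma (1 - s - α i / 2) :=
    Finset.prod_div_distrib _ _
  have hsqrt : (Real.pi : ℂ) ^ (1/2 - s) = (Real.sqrt Real.pi : ℂ) * (Real.pi : ℂ) ^ (-s) := by
    rw [sub_eq_add_neg, cpow_add _ _ hpi, Real.sqrt_eq_rpow, ofReal_cpow Real.pi_pos.le]
    norm_num
  rw [FtransMain]
  simp_rw [hinner]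
  rw [integral_const_mul, ← integral_mellinT_mul_gammaQuotient_shift hg hN hre hs₂
    (a := (3 * s.re - 1) / 2) (b := η - 1 / 2) (by linarith) (by linarith) (by linarith)
    (by linarith), integral_mellinT_mul_gammaQuotient (by linarith) hg hre hsum hs₂ (by linarith)
    (by linarith), hprod, hsqrt]
  simp only [plancherelWeight]
  generalize (∏ i, Complex.Gamma (1 - s - α i / 2)) = X
  generalize (∫ t : ℝ, _ : ℂ) = J
  field_simp
  ring
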